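/- arXiv:1908.01388 — 4 statements merged into one kernel-verified Lean document; each statement's English description precedes it below -/
import Mathlib

section
/- Let (X,c) be a complete separable metric space with at least two points such that c is an ultrametric, i.e., c(x,z) ≤ max{ c(x,y), c(y,z) } for all x, y, z ∈ X. Then r*_c(P(X)) < 7.56. -/
open MeasureTheory ENNReal

noncomputable section

/-- The optimal transport cost `C*_c(P,Q)` between two Borel measures for the cost `c`:
the infimum of `∫ c dγ` over couplings `γ` of `(P, Q)`. -/
def Cstar {X : Type*} [MeasurableSpace X] (c : X → X → ℝ) (P Q : Measure X) : ℝ≥0∞ :=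
  ⨅ γ ∈ {γ : Measure (X × X) |
      IsProbabilityMeasure γ ∧ γ.map Prod.fst = P ∧ γ.map Prod.snd = Q},
    ∫⁻ z, ENNReal.ofReal (c z.1 z.2) ∂γ

/-- The standard probability space: `[0,1]` with Lebesgue measure. -/
def stdSpace : Measure ℝ := volume.restrict (Set.Icc (0 : ℝ) 1)

/-- `f` is a coupling of the family of probability measures `P` on the standard
probability space `([0,1], Lebesgue)`: each `f a` is measurable with law `P a`. -/
structure IsCoupling {X A : Type*} [MeasurableSpace X]
    (P : A → Measure X) (f : A → ℝ → X) : Prop where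
  measurable : ∀ a, Measurable (f a)
  law : ∀ a, stdSpace.map (f a) = P a

/-- The pairwise coupling ratio `r_c({X_α})` of a coupling `f` of the family `P`:
the least `r ≥ 1` such that `E[c(X_a, X_b)] ≤ r ⬝ C*_c(P_a, P_b)` for all `a, b`
(`∞` if no such `r` exists). -/
def couplingRatio {X A : Type*} [MeasurableSpace X]
    (c : X → X → ℝ) (P : A → Measure X) (f : A → ℝ → X) : ℝ≥0∞ :=
  sInf {r : ℝ≥0∞ | 1 ≤ r ∧ ∀ a b : A,
    ∫⁻ u, ENNReal.ofReal (c (f a u) (f b u)) ∂stdSpace ≤ r * Cstar c (P a) (P b)}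

/-- The optimal pairwise coupling ratio `r*_c({P_α})` of a family of probability
measures: the infimum of `r_c({X_α})` over all couplings of the family. -/
def optRatio {X A : Type*} [MeasurableSpace X]
    (c : X → X → ℝ) (P : A → Measure X) : ℝ≥0∞ :=
  ⨅ (f : A → ℝ → X) (_ : IsCoupling P f), couplingRatio c P f

instance : IsProbabilityMeasure stdSpace := ⟨by simp [stdSpace]⟩

lemma stdSpace_Iio {x : ℝ} (hx : x ∈ Set.Icc (0 : ℝ) 1) :
    stdSpace (Set.Iio x) = ENNReal.ofReal x := by
  have h : Set.Iio x ∩ Set.Icc (0 : ℝ) 1 = Set.Ico 0 x := by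
    ext y
    simp only [Set.mem_inter_iff, Set.mem_Iio, Set.mem_Icc, Set.mem_Ico]
    constructor
    · rintro ⟨h1, h2, -⟩
      exact ⟨h2, h1⟩
    · rintro ⟨h1, h2⟩
      exact ⟨h2, h1, h2.le.trans hx.2⟩
  rw [stdSpace, Measure.restrict_apply measurableSet_Iio, h, Real.volume_Ico, sub_zero]

lemma lintegral_stdSpace_rpow {s : ℝ} (hs : 0 ≤ s) :
    ∫⁻ t in Set.Ioo (0 : ℝ) 1, ENNReal.ofReal (t ^ s) ∂stdSpace = ENNReal.ofReal (1 / (1 + s)) := by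
  have hsub : Set.Ioo (0 : ℝ) 1 ∩ Set.Icc 0 1 = Set.Ioo 0 1 :=
    Set.inter_eq_left.2 Set.Ioo_subset_Icc_self
  rw [stdSpace, Measure.restrict_restrict measurableSet_Ioo, hsub,
    Measure.restrict_congr_set Ioo_ae_eq_Ioc]
  rw [← ofReal_integral_eq_lintegral_ofReal]
  · rw [← intervalIntegral.integral_of_le zero_le_one, integral_rpow (Or.inl (by linarith))]
    rw [Real.one_rpow, Real.zero_rpow (by linarith), sub_zero, add_comm]
  · rw [← IntegrableOn, ← intervalIntegrable_iff_integrableOn_Ioc_of_le zero_le_one]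
    exact intervalIntegral.intervalIntegrable_rpow' (by linarith)
  · filter_upwards [ae_restrict_mem measurableSet_Ioc] with t ht
    exact Real.rpow_nonneg ht.1.le _

/-- A random choice of an index that realizes lower bounds for the probabilities of disjoint
events, when these bounds add up to one. -/
lemma exists_selection {Ω : Type*} [MeasurableSpace Ω] (μ : Measure Ω) [IsProbabilityMeasure μ]
    (p : Measure ℕ) [IsProbabilityMeasure p] (E : ℕ → Set Ω) (hE : ∀ m, MeasurableSet (E m))
    (hd : Pairwise (Function.onFun Disjoint E)) (hp : ∀ m, p {m} ≤ μ (E m)) :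
    ∃ h : Ω → ℕ, Measurable h ∧ μ.map h = p ∧ (∀ m, ∀ ω ∈ E m, h ω = m) ∧
      ∀ᵐ ω ∂μ, ω ∈ E (h ω) := by
  classical
  let h : Ω → ℕ := fun ω => if H : ∃ m, ω ∈ E m then H.choose else 0
  have hmem : ∀ ω, (∃ m, ω ∈ E m) → ω ∈ E (h ω) := by
    intro ω H
    simp only [h, dif_pos H]
    exact H.choose_spec
  have heq : ∀ m, ∀ ω ∈ E m, h ω = m := by
    intro m ω hω
    by_contra hne
    exact Set.disjoint_left.1 (hd hne) (hmem ω ⟨m, hω⟩) hω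
  have hmeas : Measurable h := by
    refine measurable_to_countable' fun m => ?_
    have : h ⁻¹' {m} = E m ∪ (if m = 0 then (⋃ i, E i)ᶜ else ∅) := by
      ext ω
      simp only [Set.mem_preimage, Set.mem_singleton_iff, Set.mem_union]
      constructor
      · rintro rfl
        by_cases H : ∃ m, ω ∈ E m
        · exact Or.inl (hmem ω H)
        · right
          have : h ω = 0 := by simp only [h, dif_neg H]
          rw [if_pos this]
          simpa using H
      · rintro (H | H)
        · exact heq m ω H
        · split_ifs at H with h0
          · have H' : ¬ ∃ m, ω ∈ E m := by simpa using H
            simp only [h, dif_neg H', h0]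
          · exact H.elim
    rw [this]
    refine (hE m).union ?_
    split_ifs
    · exact (MeasurableSet.iUnion hE).compl
    · exact MeasurableSet.empty
  have hprob : IsProbabilityMeasure (μ.map h) := Measure.isProbabilityMeasure_map hmeas.aemeasurable
  have hle : p ≤ μ.map h := by
    refine Measure.le_iff.2 fun s _ => ?_
    rw [← Measure.tsum_indicator_apply_singleton p s (Set.to_countable s).measurableSet,
      ← Measure.tsum_indicator_apply_singleton (μ.map h) s (Set.to_countable s).measurableSet]
    refine ENNReal.tsum_le_tsum fun m => ?_
    refine Set.indicator_le_indicator ?_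
    rw [Measure.map_apply hmeas (measurableSet_singleton m)]
    exact (hp m).trans (measure_mono fun ω hω => heq m ω hω)
  refine ⟨h, hmeas, (Measure.eq_of_le_of_isProbabilityMeasure hle).symm, heq, ?_⟩
  have hU : μ (⋃ m, E m) = 1 := by
    refine le_antisymm prob_le_one ?_
    rw [measure_iUnion hd hE]
    calc (1 : ℝ≥0∞) = p Set.univ := measure_univ.symm
      _ = ∑' m, p {m} := by
        rw [← Measure.tsum_indicator_apply_singleton p _ MeasurableSet.univ]
        simp
      _ ≤ _ := ENNReal.tsum_le_tsum hp
  have hae : ∀ᵐ ω ∂μ, ω ∈ ⋃ m, E m := (prob_compl_eq_zero_iff (MeasurableSet.iUnion hE)).2 hU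
  filter_upwards [hae] with ω hω
  exact hmem ω (Set.mem_iUnion.1 hω)

/-- The law of independent uniform variables indexed by `ℕ`. -/
def raceMeasure : Measure (ℕ → ℝ) := Measure.infinitePi fun _ => stdSpace

instance : IsProbabilityMeasure raceMeasure := by unfold raceMeasure; infer_instance

/-- The event that `j` wins the race in which the competitor `i` has relative rate `c i`. -/
def raceSet (c : ℕ → ℝ) (j : ℕ) : Set (ℕ → ℝ) :=
  {v | v j ∈ Set.Ioo (0 : ℝ) 1 ∧ ∀ i, i ≠ j → v i < v j ^ c i}

lemma measurableSet_raceSet (c : ℕ → ℝ) (j : ℕ) : MeasurableSet (raceSet c j) := by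
  have : {v : ℕ → ℝ | ∀ i, i ≠ j → v i < v j ^ c i} =
      ⋂ i, ⋂ (_ : i ≠ j), {v : ℕ → ℝ | v i < v j ^ c i} := by
    ext v; simp
  refine MeasurableSet.inter (measurable_pi_apply j measurableSet_Ioo) ?_
  refine MeasurableSet.congr ?_ this.symm
  exact MeasurableSet.iInter fun i => MeasurableSet.iInter fun _ =>
    measurableSet_lt (measurable_pi_apply i) ((measurable_pi_apply j).pow_const _)

lemma raceMeasure_finite_race (c : ℕ → ℝ) (hc : ∀ i, 0 ≤ c i) (j : ℕ) (F : Finset ℕ) (hj : j ∉ F) :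
    raceMeasure {v | v j ∈ Set.Ioo (0 : ℝ) 1 ∧ ∀ i ∈ F, v i < v j ^ c i} =
      ENNReal.ofReal (1 / (1 + ∑ i ∈ F, c i)) := by
  have hmX : Measurable fun v : ℕ → ℝ => v j := measurable_pi_apply j
  have hmY : Measurable fun (v : ℕ → ℝ) (i : F) => v i := by fun_prop
  have hind : ProbabilityTheory.IndepFun (fun v : ℕ → ℝ => v j) (fun v (i : F) => v i)
      raceMeasure := by
    have h := (ProbabilityTheory.iIndepFun_infinitePi (P := fun _ : ℕ => stdSpace)
      (X := fun _ x => x) (fun _ => measurable_id)).indepFun_finset {j} F (by simpa using hj)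
      (fun i => measurable_pi_apply i)
    have hφ : Measurable fun f : ({j} : Finset ℕ) → ℝ => f ⟨j, Finset.mem_singleton_self j⟩ := by
      fun_prop
    exact h.comp hφ measurable_id
  have hprod := (ProbabilityTheory.indepFun_iff_map_prod_eq_prod_map_map
    hmX.aemeasurable hmY.aemeasurable).1 hind
  let A : Set (ℝ × (F → ℝ)) := {z | z.1 ∈ Set.Ioo (0 : ℝ) 1 ∧ ∀ i : F, z.2 i < z.1 ^ c i}
  have hA : MeasurableSet A := by
    have : {z : ℝ × (F → ℝ) | ∀ i : F, z.2 i < z.1 ^ c i} =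
        ⋂ i : F, {z : ℝ × (F → ℝ) | z.2 i < z.1 ^ c i} := by
      ext v; simp
    refine MeasurableSet.inter (measurable_fst measurableSet_Ioo) ?_
    refine MeasurableSet.congr ?_ this.symm
    exact MeasurableSet.iInter fun i => measurableSet_lt (by fun_prop) (by fun_prop)
  have hset : {v : ℕ → ℝ | v j ∈ Set.Ioo (0 : ℝ) 1 ∧ ∀ i ∈ F, v i < v j ^ c i} =
      (fun v : ℕ → ℝ => (v j, fun i : F => v i)) ⁻¹' A := by
    ext v; simp [A]
  rw [hset, ← Measure.map_apply (hmX.prodMk hmY) hA, hprod, Measure.prod_apply hA]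
  have hX : raceMeasure.map (fun v : ℕ → ℝ => v j) = stdSpace :=
    Measure.infinitePi_map_eval (fun _ : ℕ => stdSpace) j
  rw [hX, ← lintegral_stdSpace_rpow (Finset.sum_nonneg fun i _ => hc i),
    ← lintegral_indicator measurableSet_Ioo]
  refine lintegral_congr fun t => ?_
  by_cases ht : t ∈ Set.Ioo (0 : ℝ) 1
  · rw [Set.indicator_of_mem ht, Measure.map_apply hmY (measurable_prodMk_left hA)]
    have : (fun (v : ℕ → ℝ) (i : F) => v i) ⁻¹' (Prod.mk t ⁻¹' A) =
        (F : Set ℕ).pi fun i => Set.Iio (t ^ c i) := by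
      ext v
      simp only [Set.mem_preimage, A, Set.mem_ofPred_eq, ht, true_and, Set.mem_pi, Set.mem_Iio]
      simp
    rw [this, raceMeasure, Measure.infinitePi_pi _ (fun i _ => measurableSet_Iio),
      Real.rpow_sum_of_pos ht.1, ENNReal.ofReal_prod_of_nonneg
        (fun i _ => Real.rpow_nonneg ht.1.le _)]
    refine Finset.prod_congr rfl fun i _ => stdSpace_Iio ⟨Real.rpow_nonneg ht.1.le _, ?_⟩
    exact Real.rpow_le_one ht.1.le ht.2.le (hc i)
  · rw [Set.indicator_of_notMem ht]
    have : Prod.mk t ⁻¹' A = ∅ := by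
      ext w
      simp only [Set.mem_preimage, A, Set.mem_ofPred_eq, ht, false_and, Set.mem_empty_iff_false]
    rw [this, measure_empty]

lemma le_raceMeasure_raceSet (c : ℕ → ℝ) (hc : ∀ i, 0 ≤ c i) (j : ℕ) (hj : c j = 1)
    (hs : Summable c) : ENNReal.ofReal (1 / ∑' i, c i) ≤ raceMeasure (raceSet c j) := by
  let Z : ℕ → Set (ℕ → ℝ) := fun N =>
    {v | v j ∈ Set.Ioo (0 : ℝ) 1 ∧ ∀ i ∈ (Finset.range N).erase j, v i < v j ^ c i}
  have hZm : ∀ N, MeasurableSet (Z N) := by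
    intro N
    have : {v : ℕ → ℝ | ∀ i ∈ (Finset.range N).erase j, v i < v j ^ c i} =
        ⋂ i ∈ (Finset.range N).erase j, {v : ℕ → ℝ | v i < v j ^ c i} := by
      ext v; simp only [Set.mem_ofPred_eq, Set.mem_iInter]
    refine MeasurableSet.inter (measurable_pi_apply j measurableSet_Ioo) ?_
    refine MeasurableSet.congr ?_ this.symm
    exact Finset.measurableSet_biInter _ fun i _ =>
      measurableSet_lt (measurable_pi_apply i) ((measurable_pi_apply j).pow_const _)
  have hanti : Antitone Z := by
    intro M N hMN v hv
    refine ⟨hv.1, fun i hi => hv.2 i ?_⟩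
    exact Finset.erase_subset_erase j (Finset.range_mono hMN) hi
  have hinter : raceSet c j = ⋂ N, Z N := by
    ext v
    simp only [raceSet, Set.mem_ofPred_eq, Set.mem_iInter, Z, Finset.mem_erase, Finset.mem_range]
    constructor
    · exact fun h N => ⟨h.1, fun i hi => h.2 i hi.1⟩
    · exact fun h => ⟨(h 0).1, fun i hi => (h (i + 1)).2 i ⟨hi, Nat.lt_succ_self i⟩⟩
  have hlim := tendsto_measure_iInter_atTop (μ := raceMeasure)
    (fun N => (hZm N).nullMeasurableSet) hanti ⟨0, measure_ne_top _ _⟩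
  rw [hinter]
  refine ge_of_tendsto' hlim fun N => ?_
  rw [Function.comp_apply, raceMeasure_finite_race c hc j _ (Finset.notMem_erase j _)]
  refine ENNReal.ofReal_le_ofReal ?_
  have hnn : 0 ≤ ∑ i ∈ (Finset.range N).erase j, c i := Finset.sum_nonneg fun i _ => hc i
  refine one_div_le_one_div_of_le (by linarith) ?_
  rw [← hj, ← Finset.sum_insert (Finset.notMem_erase j _)]
  exact hs.sum_le_tsum _ fun i _ => hc i

/-- The `ℓ¹` distance between the point masses of two measures on `ℕ`. -/
def L1 (p q : Measure ℕ) : ℝ≥0∞ := ∑' m, ‖p.real {m} - q.real {m}‖ₑ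

lemma hasSum_real_singleton (p : Measure ℕ) [IsProbabilityMeasure p] :
    HasSum (fun m => p.real {m}) 1 := by
  have h : ∑' m, p {m} = 1 := by
    rw [← measure_univ (μ := p), ← Measure.tsum_indicator_apply_singleton p _ MeasurableSet.univ]
    simp
  have h' := ENNReal.hasSum_toReal (f := fun m => p {m}) (by rw [h]; exact one_ne_top)
  rw [← ENNReal.tsum_toReal_eq (fun m => measure_ne_top _ _), h, ENNReal.toReal_one] at h'
  exact h'

/-- The event that `j` wins the race with rates given by the point masses of `p`. -/
def winSet (p : Measure ℕ) (j : ℕ) : Set (ℕ → ℝ) :=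
  {v | 0 < p.real {j} ∧ v ∈ raceSet (fun i => p.real {i} / p.real {j}) j}

lemma winSet_of_pos {p : Measure ℕ} {j : ℕ} (h : 0 < p.real {j}) :
    winSet p j = raceSet (fun i => p.real {i} / p.real {j}) j := by
  ext v
  exact and_iff_right h

lemma measurableSet_winSet (p : Measure ℕ) (j : ℕ) : MeasurableSet (winSet p j) :=
  MeasurableSet.inter (MeasurableSet.const _) (measurableSet_raceSet _ _)

lemma pairwise_disjoint_winSet (p : Measure ℕ) :
    Pairwise (Function.onFun Disjoint (winSet p)) := by
  intro i j hij
  refine Set.disjoint_left.2 ?_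
  rintro v ⟨hi, hi1, hi2⟩ ⟨hj, hj1, hj2⟩
  have h1 := hi2 j hij.symm
  have h2 := hj2 i hij
  have h3 := Real.rpow_lt_rpow hi1.1.le h2 (div_pos hj hi)
  rw [← Real.rpow_mul hj1.1.le, div_mul_div_cancel₀ hj.ne', div_self hi.ne', Real.rpow_one] at h3
  exact lt_irrefl _ (h1.trans h3)

lemma le_raceMeasure_winSet (p : Measure ℕ) [IsProbabilityMeasure p] (m : ℕ) :
    p {m} ≤ raceMeasure (winSet p m) := by
  rcases (measureReal_nonneg (μ := p) (s := {m})).eq_or_lt with h | h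
  · rw [eq_comm, measureReal_eq_zero_iff] at h
    simp [h]
  · rw [winSet_of_pos h]
    have hs := (hasSum_real_singleton p).div_const (p.real {m})
    refine le_trans ?_ (le_raceMeasure_raceSet _ (fun i => by positivity) m (div_self h.ne')
      hs.summable)
    rw [hs.tsum_eq, one_div_one_div, ofReal_measureReal]

lemma exists_selector (p : Measure ℕ) [IsProbabilityMeasure p] :
    ∃ T : (ℕ → ℝ) → ℕ, Measurable T ∧ raceMeasure.map T = p ∧ ∀ m, ∀ v ∈ winSet p m, T v = m := by
  obtain ⟨T, h1, h2, h3, -⟩ := exists_selection raceMeasure p (winSet p) (measurableSet_winSet p)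
    (pairwise_disjoint_winSet p) (le_raceMeasure_winSet p)
  exact ⟨T, h1, h2, h3⟩

open Classical in
/-- The winner of the race with rates given by the point masses of `p`. -/
def sel (p : Measure ℕ) : (ℕ → ℝ) → ℕ :=
  if _h : IsProbabilityMeasure p then (exists_selector p).choose else fun _ => 0

lemma measurable_sel (p : Measure ℕ) : Measurable (sel p) := by
  unfold sel
  split_ifs with h
  · exact (exists_selector p).choose_spec.1
  · exact measurable_const

lemma map_sel (p : Measure ℕ) [h : IsProbabilityMeasure p] : raceMeasure.map (sel p) = p := by
  simp only [sel, dif_pos h]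
  exact (exists_selector p).choose_spec.2.1

lemma sel_eq_of_mem (p : Measure ℕ) [h : IsProbabilityMeasure p] {m : ℕ} {v : ℕ → ℝ}
    (hv : v ∈ winSet p m) : sel p v = m := by
  simp only [sel, dif_pos h]
  exact (exists_selector p).choose_spec.2.2 m v hv

lemma raceMeasure_sel_ne_le (p q : Measure ℕ) [IsProbabilityMeasure p] [IsProbabilityMeasure q] :
    raceMeasure {v | sel p v ≠ sel q v} ≤ L1 p q := by
  have hp := hasSum_real_singleton p
  have hq := hasSum_real_singleton q
  set P : ℕ → ℝ := fun m => p.real {m} with hP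
  set Q : ℕ → ℝ := fun m => q.real {m} with hQ
  have hP0 : ∀ m, 0 ≤ P m := fun m => measureReal_nonneg
  have hQ0 : ∀ m, 0 ≤ Q m := fun m => measureReal_nonneg
  have hmxs : Summable fun m => max (P m) (Q m) :=
    Summable.of_nonneg_of_le (fun m => (hP0 m).trans (le_max_left _ _))
      (fun m => max_le_add_of_nonneg (hP0 m) (hQ0 m)) (hp.add hq).summable
  obtain ⟨M, hM⟩ := hmxs
  have hmn : HasSum (fun m => min (P m) (Q m)) (2 - M) := by
    have h : (fun m => min (P m) (Q m)) = fun m => P m + Q m - max (P m) (Q m) := by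
      funext m
      have := max_add_min (P m) (Q m)
      linarith
    rw [h, show 2 - M = 1 + 1 - M by ring]
    exact (hp.add hq).sub hM
  have habs : HasSum (fun m => |P m - Q m|) (2 * (M - 1)) := by
    have h : (fun m => |P m - Q m|) = fun m => max (P m) (Q m) - min (P m) (Q m) := by
      funext m
      exact (max_sub_min_eq_abs' (P m) (Q m)).symm
    rw [h, show 2 * (M - 1) = M - (2 - M) by ring]
    exact hM.sub hmn
  have hM1 : 1 ≤ M := hasSum_le (fun m => le_max_left _ _) hp hM
  have hL1 : L1 p q = ENNReal.ofReal (2 * (M - 1)) := by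
    rw [← habs.tsum_eq, ENNReal.ofReal_tsum_of_nonneg (fun m => abs_nonneg _) habs.summable]
    exact tsum_congr fun m => Real.enorm_eq_ofReal_abs _
  have hboth : ∀ j, ENNReal.ofReal (min (P j) (Q j) / M) ≤
      raceMeasure (winSet p j ∩ winSet q j) := by
    intro j
    by_cases hpos : 0 < P j ∧ 0 < Q j
    · obtain ⟨hpj, hqj⟩ := hpos
      rw [winSet_of_pos hpj, winSet_of_pos hqj]
      have hmpos : 0 < min (P j) (Q j) := lt_min hpj hqj
      let c : ℕ → ℝ := fun i => max (P i / P j) (Q i / Q j)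
      have hc0 : ∀ i, 0 ≤ c i := fun i => le_max_of_le_left (div_nonneg (hP0 i) hpj.le)
      have hcle : ∀ i, c i ≤ max (P i) (Q i) / min (P j) (Q j) := by
        intro i
        refine max_le ?_ ?_
        · exact div_le_div₀ ((hP0 i).trans (le_max_left _ _)) (le_max_left _ _) hmpos
            (min_le_left _ _)
        · exact div_le_div₀ ((hP0 i).trans (le_max_left _ _)) (le_max_right _ _) hmpos
            (min_le_right _ _)
      have hdiv := hM.div_const (min (P j) (Q j))
      have hcs : Summable c := Summable.of_nonneg_of_le hc0 hcle hdiv.summable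
      have hcj : c j = 1 := by simp [c, div_self hpj.ne', div_self hqj.ne']
      have hsum1 : 1 ≤ ∑' i, c i := by
        rw [← hcj]
        exact hcs.le_tsum j fun i _ => hc0 i
      calc ENNReal.ofReal (min (P j) (Q j) / M) ≤ ENNReal.ofReal (1 / ∑' i, c i) := by
            refine ENNReal.ofReal_le_ofReal ?_
            have h1 : ∑' i, c i ≤ M / min (P j) (Q j) := by
              rw [← hdiv.tsum_eq]
              exact hcs.tsum_le_tsum hcle hdiv.summable
            rw [← one_div_div M]
            exact one_div_le_one_div_of_le (by linarith) h1
        _ ≤ raceMeasure (raceSet c j) := le_raceMeasure_raceSet c hc0 j hcj hcs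
        _ ≤ _ := by
            refine measure_mono ?_
            rintro v ⟨hv1, hv2⟩
            refine ⟨⟨hv1, fun i hi => (hv2 i hi).trans_le ?_⟩,
              ⟨hv1, fun i hi => (hv2 i hi).trans_le ?_⟩⟩
            · exact Real.rpow_le_rpow_of_exponent_ge hv1.1 hv1.2.le (le_max_left _ _)
            · exact Real.rpow_le_rpow_of_exponent_ge hv1.1 hv1.2.le (le_max_right _ _)
    · have : min (P j) (Q j) ≤ 0 := by
        by_contra! h
        exact hpos ⟨h.trans_le (min_le_left _ _), h.trans_le (min_le_right _ _)⟩
      rw [ENNReal.ofReal_of_nonpos (div_nonpos_of_nonpos_of_nonneg this (by linarith))]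
      exact zero_le
  have heq : ENNReal.ofReal ((2 - M) / M) ≤ raceMeasure {v | sel p v = sel q v} := by
    have hdiv := hmn.div_const M
    rw [← hdiv.tsum_eq, ENNReal.ofReal_tsum_of_nonneg
      (fun m => div_nonneg (le_min (hP0 m) (hQ0 m)) (by linarith)) hdiv.summable]
    refine (ENNReal.tsum_le_tsum hboth).trans ?_
    rw [← measure_iUnion]
    · refine measure_mono ?_
      refine Set.iUnion_subset fun j v hv => ?_
      exact (sel_eq_of_mem p hv.1).trans (sel_eq_of_mem q hv.2).symm
    · intro i j hij
      exact (pairwise_disjoint_winSet p hij).mono Set.inter_subset_left Set.inter_subset_left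
    · exact fun j => (measurableSet_winSet p j).inter (measurableSet_winSet q j)
  have hcompl : {v | sel p v ≠ sel q v} = {v | sel p v = sel q v}ᶜ := rfl
  rw [hcompl, prob_compl_eq_one_sub (measurableSet_eq_fun (measurable_sel p) (measurable_sel q)),
    hL1]
  refine (tsub_le_tsub_left heq 1).trans ?_
  by_cases h2 : 0 ≤ 2 - M
  · rw [← ENNReal.ofReal_one, ← ENNReal.ofReal_sub _ (div_nonneg h2 (by linarith))]
    refine ENNReal.ofReal_le_ofReal ?_
    have hMpos : 0 < M := by linarith
    have : 1 - (2 - M) / M = 2 * (M - 1) / M := by field_simp; ring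
    rw [this]
    exact div_le_self (by linarith) hM1
  · refine tsub_le_self.trans ?_
    rw [← ENNReal.ofReal_one]
    exact ENNReal.ofReal_le_ofReal (by linarith)

lemma tsum_measure_inter_preimage_singleton {X : Type*} [MeasurableSpace X] (P : Measure X)
    {B : Set X} (hB : MeasurableSet B) {f : X → ℕ} (hf : Measurable f) :
    ∑' m, P (B ∩ f ⁻¹' {m}) = P B := by
  rw [← measure_iUnion]
  · congr 1
    ext x
    simp
  · intro i j hij
    refine Set.disjoint_left.2 ?_
    rintro x ⟨-, h1⟩ ⟨-, h2⟩
    exact hij (h1.symm.trans h2)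
  · exact fun m => hB.inter (hf (measurableSet_singleton m))

lemma measure_mul_L1_cond_le {X : Type*} [MeasurableSpace X] (P Q : Measure X)
    [IsProbabilityMeasure P] [IsProbabilityMeasure Q] {B : Set X} (hB : MeasurableSet B)
    {f : X → ℕ} (hf : Measurable f) (hPQ : Q B ≤ P B) :
    Q B * L1 ((ProbabilityTheory.cond P B).map f) ((ProbabilityTheory.cond Q B).map f) ≤
      ∑' m, ‖P.real (B ∩ f ⁻¹' {m}) - Q.real (B ∩ f ⁻¹' {m})‖ₑ + ‖P.real B - Q.real B‖ₑ := by
  have hle : Q.real B ≤ P.real B := ENNReal.toReal_mono (measure_ne_top _ _) hPQ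
  rcases (measureReal_nonneg (μ := Q) (s := B)).eq_or_lt with h | hq
  · rw [eq_comm, measureReal_eq_zero_iff] at h
    simp [h]
  have hp : 0 < P.real B := hq.trans_le hle
  have hr : 0 ≤ 1 - Q.real B / P.real B := by
    rw [sub_nonneg, div_le_one hp]
    exact hle
  have hQB : Q B = ‖Q.real B‖ₑ := by
    rw [Real.enorm_of_nonneg hq.le, ofReal_measureReal]
  have hcond : ∀ (μ : Measure X) [IsProbabilityMeasure μ] (t : Set X),
      (ProbabilityTheory.cond μ B).real t = (μ.real B)⁻¹ * μ.real (B ∩ t) := by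
    intro μ _ t
    simp [measureReal_def, ProbabilityTheory.cond_apply hB]
  rw [L1, hQB, ← ENNReal.tsum_mul_left]
  have hlast : ‖P.real B - Q.real B‖ₑ =
      ∑' m, P (B ∩ f ⁻¹' {m}) * ENNReal.ofReal (1 - Q.real B / P.real B) := by
    rw [ENNReal.tsum_mul_right, tsum_measure_inter_preimage_singleton P hB hf,
      Real.enorm_of_nonneg (sub_nonneg.2 hle), ← ofReal_measureReal (μ := P) (s := B),
      ← ENNReal.ofReal_mul hp.le]
    congr 1
    field_simp
  rw [hlast, ← ENNReal.tsum_add]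
  refine ENNReal.tsum_le_tsum fun m => ?_
  rw [map_measureReal_apply hf (measurableSet_singleton m),
    map_measureReal_apply hf (measurableSet_singleton m), hcond P, hcond Q, ← enorm_mul]
  set a := P.real (B ∩ f ⁻¹' {m}) with ha
  set b := Q.real (B ∩ f ⁻¹' {m}) with hb
  have ha0 : 0 ≤ a := measureReal_nonneg
  have hpa : P (B ∩ f ⁻¹' {m}) * ENNReal.ofReal (1 - Q.real B / P.real B) =
      ‖a * (1 - Q.real B / P.real B)‖ₑ := by
    rw [Real.enorm_of_nonneg (mul_nonneg ha0 hr), ENNReal.ofReal_mul ha0, ha, ofReal_measureReal]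
  rw [hpa]
  have : Q.real B * ((P.real B)⁻¹ * a - (Q.real B)⁻¹ * b) =
      (a - b) - a * (1 - Q.real B / P.real B) := by
    field_simp
    ring
  rw [this]
  exact enorm_sub_le

lemma min_mul_L1_cond_le {X : Type*} [MeasurableSpace X] (P Q : Measure X)
    [IsProbabilityMeasure P] [IsProbabilityMeasure Q] {B : Set X} (hB : MeasurableSet B)
    {f : X → ℕ} (hf : Measurable f) :
    min (P B) (Q B) * L1 ((ProbabilityTheory.cond P B).map f) ((ProbabilityTheory.cond Q B).map f) ≤
      ∑' m, ‖P.real (B ∩ f ⁻¹' {m}) - Q.real (B ∩ f ⁻¹' {m})‖ₑ + ‖P.real B - Q.real B‖ₑ := by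
  have hsymm : ∀ x y : ℝ, ‖x - y‖ₑ = ‖y - x‖ₑ := fun x y => by rw [← enorm_neg, neg_sub]
  rcases le_total (Q B) (P B) with h | h
  · rw [min_eq_right h]
    exact measure_mul_L1_cond_le P Q hB hf h
  · rw [min_eq_left h]
    have := measure_mul_L1_cond_le Q P hB hf h
    simp only [L1] at this ⊢
    simpa only [hsymm (Q.real _), hsymm (((ProbabilityTheory.cond Q B).map f).real _)] using this

lemma min_mul_raceMeasure_sel_ne_le {X : Type*} [MeasurableSpace X] (P Q : Measure X)
    [IsProbabilityMeasure P] [IsProbabilityMeasure Q] {B : Set X} (hB : MeasurableSet B)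
    {f : X → ℕ} (hf : Measurable f) :
    min (P B) (Q B) * raceMeasure {v | sel ((ProbabilityTheory.cond P B).map f) v ≠
        sel ((ProbabilityTheory.cond Q B).map f) v} ≤
      ∑' m, ‖P.real (B ∩ f ⁻¹' {m}) - Q.real (B ∩ f ⁻¹' {m})‖ₑ + ‖P.real B - Q.real B‖ₑ := by
  by_cases h0 : min (P B) (Q B) = 0
  · simp [h0]
  have hP : P B ≠ 0 := fun h => h0 (by simp [h])
  have hQ : Q B ≠ 0 := fun h => h0 (by simp [h])
  have := ProbabilityTheory.cond_isProbabilityMeasure hP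
  have := ProbabilityTheory.cond_isProbabilityMeasure hQ
  have := Measure.isProbabilityMeasure_map (μ := ProbabilityTheory.cond P B) hf.aemeasurable
  have := Measure.isProbabilityMeasure_map (μ := ProbabilityTheory.cond Q B) hf.aemeasurable
  refine le_trans ?_ (min_mul_L1_cond_le P Q hB hf)
  gcongr
  exact raceMeasure_sel_ne_le _ _

section Ultrametric

open Filter Topology

variable {X : Type*} [MetricSpace X] [TopologicalSpace.SeparableSpace X] [Nonempty X]

/-- The index of the closed ball of radius `r` containing `x`: the first member of a dense
sequence lying in that ball. -/
def idx (r : ℝ) (x : X) : ℕ := sInf {m | dist (TopologicalSpace.denseSeq X m) x ≤ r}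

lemma dist_denseSeq_idx_le {r : ℝ} (hr : 0 < r) (x : X) :
    dist (TopologicalSpace.denseSeq X (idx r x)) x ≤ r := by
  have hne : {m | dist (TopologicalSpace.denseSeq X m) x ≤ r}.Nonempty := by
    obtain ⟨m, hm⟩ := (TopologicalSpace.denseRange_denseSeq X).exists_dist_lt x hr
    exact ⟨m, by rw [Set.mem_ofPred_eq, dist_comm]; exact hm.le⟩
  exact Nat.sInf_mem hne

variable [IsUltrametricDist X]

lemma idx_eq_iff {r : ℝ} (hr : 0 < r) {x y : X} : idx r x = idx r y ↔ dist x y ≤ r := by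
  constructor
  · intro h
    have h1 := dist_denseSeq_idx_le hr x
    have h2 := dist_denseSeq_idx_le hr y
    rw [h] at h1
    refine (dist_triangle_max x (TopologicalSpace.denseSeq X (idx r y)) y).trans (max_le ?_ h2)
    rwa [dist_comm]
  · intro h
    have : ∀ z : X, dist z x ≤ r ↔ dist z y ≤ r := fun z =>
      ⟨fun hz => (dist_triangle_max z x y).trans (max_le hz h),
        fun hz => (dist_triangle_max z y x).trans (max_le hz (by rwa [dist_comm]))⟩
    simp only [idx, this]

lemma idx_denseSeq_idx {r : ℝ} (hr : 0 < r) (x : X) :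
    idx r (TopologicalSpace.denseSeq X (idx r x)) = idx r x :=
  (idx_eq_iff hr).2 (dist_denseSeq_idx_le hr x)

lemma idx_eq_of_le {r r' : ℝ} (hr : 0 < r) (hrr' : r ≤ r') {x y : X} (h : idx r x = idx r y) :
    idx r' x = idx r' y :=
  (idx_eq_iff (hr.trans_le hrr')).2 (((idx_eq_iff hr).1 h).trans hrr')

lemma isOpen_preimage_idx {r : ℝ} (hr : 0 < r) (s : Set ℕ) : IsOpen (idx r ⁻¹' s : Set X) := by
  refine Metric.isOpen_iff.2 fun x hx => ⟨r, hr, fun y hy => ?_⟩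
  rw [Set.mem_preimage, (idx_eq_iff hr).2 (Metric.mem_ball.1 hy).le]
  exact hx

variable [MeasurableSpace X] [BorelSpace X]

lemma measurable_idx {r : ℝ} (hr : 0 < r) : Measurable (idx r : X → ℕ) :=
  fun s _ => (isOpen_preimage_idx hr s).measurableSet

set_option linter.unusedSectionVars false

/-- A two-sided increasing sequence of positive radii, tending to zero and to infinity. -/
structure IsScale (D : ℤ → ℝ) : Prop where
  pos : ∀ k, 0 < D k
  mono : Monotone D
  small : ∀ ε, 0 < ε → ∃ k, D k < ε
  large : ∀ R, ∃ k, R ≤ D k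

/-- Source of randomness with an independent race attached to each node of a tree. -/
def treeMeasure : Measure (ℤ × ℕ → ℕ → ℝ) := Measure.infinitePi fun _ => raceMeasure

instance : IsProbabilityMeasure treeMeasure := by unfold treeMeasure; infer_instance

/-- The conditional law of the ball of radius `D k`, given the ball of radius `D (k + 1)`. -/
def stepLaw (D : ℤ → ℝ) (P : Measure X) (k : ℤ) (b : ℕ) : Measure ℕ :=
  (ProbabilityTheory.cond P (idx (D (k + 1)) ⁻¹' {b})).map (idx (D k))

/-- The outcomes of the race at scale `k` that select the ball containing `x`. -/
def stepSet (D : ℤ → ℝ) (P : Measure X) (k : ℤ) (x : X) : Set (ℕ → ℝ) :=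
  {v | sel (stepLaw D P k (idx (D (k + 1)) x)) v = idx (D k) x}

/-- The event that all races at scales `k` and above select the ball containing `x`. -/
def pathSet (D : ℤ → ℝ) (P : Measure X) (k : ℤ) (x : X) : Set (ℤ × ℕ → ℕ → ℝ) :=
  {ω | ∀ n : ℕ, ω (k + n, idx (D (k + n + 1)) x) ∈ stepSet D P (k + n) x}

lemma measurableSet_stepSet (D : ℤ → ℝ) (P : Measure X) (k : ℤ) (x : X) :
    MeasurableSet (stepSet D P k x) :=
  measurable_sel _ (measurableSet_singleton _)

lemma measurableSet_pathSet (D : ℤ → ℝ) (P : Measure X) (k : ℤ) (x : X) :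
    MeasurableSet (pathSet D P k x) := by
  have : pathSet D P k x = ⋂ n : ℕ, (fun ω : ℤ × ℕ → ℕ → ℝ =>
      ω (k + n, idx (D (k + n + 1)) x)) ⁻¹' stepSet D P (k + n) x := by
    ext ω
    simp [pathSet]
  rw [this]
  exact MeasurableSet.iInter fun n => measurable_pi_apply _ (measurableSet_stepSet D P _ x)

lemma pathSet_mono (D : ℤ → ℝ) (P : Measure X) {k l : ℤ} (hkl : k ≤ l) (x : X) :
    pathSet D P k x ⊆ pathSet D P l x := by
  intro ω hω n
  obtain ⟨m, rfl⟩ := Int.le.dest hkl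
  have := hω (m + n)
  push_cast at this
  rwa [← add_assoc] at this

lemma pathSet_congr {D : ℤ → ℝ} (hD : IsScale D) (P : Measure X) {k : ℤ} {x y : X}
    (h : idx (D k) x = idx (D k) y) : pathSet D P k x = pathSet D P k y := by
  have h' : ∀ l, k ≤ l → idx (D l) x = idx (D l) y := fun l hl =>
    idx_eq_of_le (hD.pos k) (hD.mono hl) h
  ext ω
  simp only [pathSet, stepSet, Set.mem_ofPred_eq]
  refine forall_congr' fun n => ?_
  rw [h' (k + n) (by lia), h' (k + n + 1) (by lia)]

lemma measure_mul_raceMeasure_stepSet {D : ℤ → ℝ} (hD : IsScale D) (P : Measure X)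
    [IsProbabilityMeasure P] (k : ℤ) (x : X) :
    P (idx (D (k + 1)) ⁻¹' {idx (D (k + 1)) x}) * raceMeasure (stepSet D P k x) =
      P (idx (D k) ⁻¹' {idx (D k) x}) := by
  have hsub : (idx (D k) ⁻¹' {idx (D k) x} : Set X) ⊆ idx (D (k + 1)) ⁻¹' {idx (D (k + 1)) x} :=
    fun y hy => idx_eq_of_le (hD.pos k) (hD.mono (by lia)) hy
  have hB : MeasurableSet (idx (D (k + 1)) ⁻¹' {idx (D (k + 1)) x} : Set X) :=
    measurable_idx (hD.pos _) (measurableSet_singleton _)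
  by_cases h0 : P (idx (D (k + 1)) ⁻¹' {idx (D (k + 1)) x}) = 0
  · rw [h0, zero_mul, measure_mono_null hsub h0]
  have := ProbabilityTheory.cond_isProbabilityMeasure h0
  have hstep : IsProbabilityMeasure (stepLaw D P k (idx (D (k + 1)) x)) :=
    Measure.isProbabilityMeasure_map (measurable_idx (hD.pos k)).aemeasurable
  have h1 : raceMeasure (stepSet D P k x) =
      stepLaw D P k (idx (D (k + 1)) x) {idx (D k) x} := by
    conv_rhs => rw [← map_sel (stepLaw D P k (idx (D (k + 1)) x))]
    rw [Measure.map_apply (measurable_sel _) (measurableSet_singleton _)]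
    rfl
  rw [h1, stepLaw, Measure.map_apply (measurable_idx (hD.pos k)) (measurableSet_singleton _),
    mul_comm, ProbabilityTheory.cond_mul_eq_inter hB, Set.inter_eq_right.2 hsub]

lemma measure_mul_prod_stepSet {D : ℤ → ℝ} (hD : IsScale D) (P : Measure X)
    [IsProbabilityMeasure P] (k : ℤ) (x : X) (N : ℕ) :
    P (idx (D (k + N)) ⁻¹' {idx (D (k + N)) x}) *
      ∏ n ∈ Finset.range N, raceMeasure (stepSet D P (k + n) x) =
      P (idx (D k) ⁻¹' {idx (D k) x}) := by
  induction N with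
  | zero => simp
  | succ N ih =>
    rw [Finset.prod_range_succ, ← ih, ← measure_mul_raceMeasure_stepSet hD P (k + N) x]
    push_cast
    rw [← add_assoc]
    ring

lemma treeMeasure_biInter_range {i : ℕ → ℤ × ℕ} (hi : Function.Injective i)
    {A : ℕ → Set (ℕ → ℝ)} (hA : ∀ n, MeasurableSet (A n)) (N : ℕ) :
    treeMeasure (⋂ n ∈ Finset.range N, {ω | ω (i n) ∈ A n}) =
      ∏ n ∈ Finset.range N, raceMeasure (A n) := by
  have h := (ProbabilityTheory.iIndepFun_infinitePi (P := fun _ : ℤ × ℕ => raceMeasure)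
    (X := fun _ x => x) (fun _ => measurable_id)).precomp hi
  have h' := h.measure_inter_preimage_eq_mul (Finset.range N) (sets := A) (fun n _ => hA n)
  refine h'.trans (Finset.prod_congr rfl fun n _ => ?_)
  exact (measurePreserving_eval_infinitePi (fun _ : ℤ × ℕ => raceMeasure) (i n)).measure_preimage
    (hA n).nullMeasurableSet

lemma injective_path_index (D : ℤ → ℝ) (k : ℤ) (x : X) :
    Function.Injective fun n : ℕ => ((k + n, idx (D (k + n + 1)) x) : ℤ × ℕ) := by
  intro m n h
  have := congrArg Prod.fst h
  simpa using this

lemma le_treeMeasure_pathSet {D : ℤ → ℝ} (hD : IsScale D) (P : Measure X)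
    [IsProbabilityMeasure P] (k : ℤ) (x : X) :
    P (idx (D k) ⁻¹' {idx (D k) x}) ≤ treeMeasure (pathSet D P k x) := by
  let Z : ℕ → Set (ℤ × ℕ → ℕ → ℝ) := fun N => ⋂ n ∈ Finset.range N,
    {ω | ω (k + n, idx (D (k + n + 1)) x) ∈ stepSet D P (k + n) x}
  have hZm : ∀ N, MeasurableSet (Z N) := fun N => Finset.measurableSet_biInter _ fun n _ =>
    measurable_pi_apply _ (measurableSet_stepSet D P _ x)
  have hanti : Antitone Z := fun M N hMN =>
    Set.biInter_subset_biInter_left (Finset.range_mono hMN)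
  have hinter : pathSet D P k x = ⋂ N, Z N := by
    ext ω
    simp only [pathSet, Set.mem_ofPred_eq, Set.mem_iInter, Z, Finset.mem_range]
    exact ⟨fun h N n _ => h n, fun h n => h (n + 1) n (Nat.lt_succ_self n)⟩
  have hlim := tendsto_measure_iInter_atTop (μ := treeMeasure)
    (fun N => (hZm N).nullMeasurableSet) hanti ⟨0, measure_ne_top _ _⟩
  rw [hinter]
  refine ge_of_tendsto' hlim fun N => ?_
  rw [Function.comp_apply, treeMeasure_biInter_range (injective_path_index D k x)
    (fun n => measurableSet_stepSet D P _ x), ← measure_mul_prod_stepSet hD P k x N]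
  exact mul_le_of_le_one_left zero_le prob_le_one

lemma tendsto_measure_idx_preimage {D : ℤ → ℝ} (hD : IsScale D) (P : Measure X)
    [IsProbabilityMeasure P] (k : ℤ) (x : X) :
    Tendsto (fun N : ℕ => P (idx (D (k + N)) ⁻¹' {idx (D (k + N)) x})) atTop (𝓝 1) := by
  have hmono : Monotone fun N : ℕ => (idx (D (k + N)) ⁻¹' {idx (D (k + N)) x} : Set X) :=
    fun M N hMN y hy => idx_eq_of_le (hD.pos _) (hD.mono (by gcongr)) hy
  have h := tendsto_measure_iUnion_atTop (μ := P) hmono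
  have hU : ⋃ N : ℕ, (idx (D (k + N)) ⁻¹' {idx (D (k + N)) x} : Set X) = Set.univ := by
    refine Set.eq_univ_of_forall fun y => Set.mem_iUnion.2 ?_
    obtain ⟨l, hl⟩ := hD.large (dist y x)
    refine ⟨(l - k).toNat, (idx_eq_iff (hD.pos _)).2 (hl.trans (hD.mono ?_))⟩
    have := Int.self_le_toNat (l - k)
    lia
  rw [hU, measure_univ] at h
  exact h

lemma treeMeasure_pathSet_inter_le {D : ℤ → ℝ} (hD : IsScale D) (P : Measure X)
    [IsProbabilityMeasure P] (k : ℤ) (x : X) {A : Set (ℕ → ℝ)} (hA : MeasurableSet A) :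
    treeMeasure (pathSet D P (k + 1) x ∩ {ω | ω (k, idx (D (k + 1)) x) ∈ A}) ≤
      P (idx (D (k + 1)) ⁻¹' {idx (D (k + 1)) x}) * raceMeasure A := by
  set E := pathSet D P (k + 1) x ∩ {ω | ω (k, idx (D (k + 1)) x) ∈ A} with hE
  have hN : ∀ N : ℕ, P (idx (D (k + 1 + N)) ⁻¹' {idx (D (k + 1 + N)) x}) * treeMeasure E ≤
      P (idx (D (k + 1)) ⁻¹' {idx (D (k + 1)) x}) * raceMeasure A := by
    intro N
    let A' : ℕ → Set (ℕ → ℝ) := fun n => if n = 0 then A else stepSet D P (k + n) x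
    have hA' : ∀ n, MeasurableSet (A' n) := by
      intro n
      simp only [A']
      split_ifs
      · exact hA
      · exact measurableSet_stepSet D P _ x
    have hcast : ∀ n : ℕ, k + ((n + 1 : ℕ) : ℤ) = k + 1 + n := fun n => by push_cast; ring
    have hsub : E ⊆ ⋂ n ∈ Finset.range (N + 1),
        {ω | ω (k + n, idx (D (k + n + 1)) x) ∈ A' n} := by
      rintro ω ⟨h1, h2⟩
      simp only [Set.mem_iInter]
      intro n _
      cases n with
      | zero => simpa [A'] using h2
      | succ n =>
        have := h1 n
        simp only [A', Set.mem_ofPred_eq, hcast, Nat.succ_ne_zero, if_false]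
        exact this
    have hm := (measure_mono hsub).trans_eq
      (treeMeasure_biInter_range (injective_path_index D k x) hA' (N + 1))
    rw [Finset.prod_range_succ'] at hm
    have h0 : A' 0 = A := by simp [A']
    have hs : ∀ n : ℕ, A' (n + 1) = stepSet D P (k + 1 + n) x := by
      intro n
      simp only [A', hcast, Nat.succ_ne_zero, if_false]
    simp only [h0, hs] at hm
    calc _ ≤ _ := mul_le_mul_right hm _
      _ = _ := by rw [← mul_assoc, measure_mul_prod_stepSet hD P (k + 1) x N]
  have hlim := ENNReal.Tendsto.mul_const (b := treeMeasure E)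
    (tendsto_measure_idx_preimage hD P (k + 1) x) (Or.inl one_ne_zero)
  rw [one_mul] at hlim
  exact le_of_tendsto' hlim hN

lemma exists_idx_ne_idx_succ_eq {D : ℤ → ℝ} (hD : IsScale D) {x y : X} (hxy : x ≠ y) :
    ∃ k, idx (D k) x ≠ idx (D k) y ∧ idx (D (k + 1)) x = idx (D (k + 1)) y := by
  obtain ⟨a, ha⟩ := hD.small _ (dist_pos.2 hxy)
  obtain ⟨b, hb⟩ := hD.large (dist x y)
  obtain ⟨l, hl, hmin⟩ := Int.exists_least_of_bdd
    (P := fun l => idx (D l) x = idx (D l) y)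
    ⟨a, fun z hz => by
      by_contra h
      exact absurd (((idx_eq_iff (hD.pos z)).1 hz).trans (hD.mono (not_le.1 h).le)) ha.not_ge⟩
    ⟨b, (idx_eq_iff (hD.pos b)).2 hb⟩
  refine ⟨l - 1, fun h => ?_, by simpa using hl⟩
  have := hmin _ h
  lia

lemma idx_eq_of_mem_pathSet {D : ℤ → ℝ} (hD : IsScale D) {P : Measure X} {k : ℤ} {x y : X}
    {ω : ℤ × ℕ → ℕ → ℝ} (hx : ω ∈ pathSet D P k x) (hy : ω ∈ pathSet D P k y) :
    idx (D k) x = idx (D k) y := by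
  by_contra h
  obtain ⟨l, hl, hl'⟩ := exists_idx_ne_idx_succ_eq hD (x := x) (y := y)
    (fun hxy => h (by rw [hxy]))
  have hkl : k ≤ l := by
    by_contra hlt
    exact h (idx_eq_of_le (hD.pos _) (hD.mono (by lia)) hl')
  obtain ⟨n, rfl⟩ := Int.le.dest hkl
  have h1 := hx n
  have h2 := hy n
  rw [stepSet, Set.mem_ofPred_eq] at h1 h2
  rw [hl'] at h1
  exact hl (h1.symm.trans h2)

lemma ext_of_map_idx {D : ℤ → ℝ} (hD : IsScale D) [SecondCountableTopology X] {P Q : Measure X}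
    [IsProbabilityMeasure P] [IsProbabilityMeasure Q]
    (h : ∀ k m, P (idx (D k) ⁻¹' {m}) = Q (idx (D k) ⁻¹' {m})) : P = Q := by
  let C : Set (Set X) := {s | ∃ k m, s = idx (D k) ⁻¹' {m}}
  have hC : TopologicalSpace.IsTopologicalBasis C := by
    refine TopologicalSpace.isTopologicalBasis_of_isOpen_of_nhds ?_ ?_
    · rintro _ ⟨k, m, rfl⟩
      exact isOpen_preimage_idx (hD.pos k) _
    · intro x u hx hu
      obtain ⟨ε, hε, hball⟩ := Metric.isOpen_iff.1 hu x hx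
      obtain ⟨k, hk⟩ := hD.small ε hε
      refine ⟨_, ⟨k, idx (D k) x, rfl⟩, rfl, fun y hy => hball ?_⟩
      exact ((idx_eq_iff (hD.pos k)).1 hy).trans_lt hk
  have hpi : IsPiSystem C := by
    rintro _ ⟨k, m, rfl⟩ _ ⟨l, n, rfl⟩ ⟨x, hx, hx'⟩
    rcases le_total k l with hkl | hkl
    · refine ⟨k, m, Set.inter_eq_left.2 fun y hy => ?_⟩
      exact (idx_eq_of_le (hD.pos k) (hD.mono hkl) (hy.trans hx.symm)).trans hx'
    · refine ⟨l, n, Set.inter_eq_right.2 fun y hy => ?_⟩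
      exact (idx_eq_of_le (hD.pos l) (hD.mono hkl) (hy.trans hx'.symm)).trans hx
  refine ext_of_generate_finite C ?_ hpi ?_ (by simp)
  · rw [BorelSpace.measurable_eq (α := X), hC.borel_eq_generateFrom]
  · rintro _ ⟨k, m, rfl⟩
    exact h k m

lemma exists_tree_map [CompleteSpace X] {D : ℤ → ℝ} (hD : IsScale D) (P : Measure X)
    [IsProbabilityMeasure P] :
    ∃ f : (ℤ × ℕ → ℕ → ℝ) → X, Measurable f ∧ treeMeasure.map f = P ∧
      ∀ᵐ ω ∂treeMeasure, ∀ k, ω ∈ pathSet D P k (f ω) := by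
  have : SecondCountableTopology X := UniformSpace.secondCountable_of_separable X
  let d := TopologicalSpace.denseSeq X
  let E : ℤ → ℕ → Set (ℤ × ℕ → ℕ → ℝ) := fun k m =>
    {ω | idx (D k) (d m) = m ∧ ω ∈ pathSet D P k (d m)}
  have hE : ∀ k m, MeasurableSet (E k m) := fun k m =>
    MeasurableSet.inter (MeasurableSet.const _) (measurableSet_pathSet D P k (d m))
  have hdisj : ∀ k, Pairwise (Function.onFun Disjoint (E k)) := by
    intro k m n hmn
    refine Set.disjoint_left.2 fun ω h1 h2 => hmn ?_
    rw [← h1.1, ← h2.1, idx_eq_of_mem_pathSet hD h1.2 h2.2]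
  have hpr : ∀ k, IsProbabilityMeasure (P.map (idx (D k))) := fun k =>
    Measure.isProbabilityMeasure_map (measurable_idx (hD.pos k)).aemeasurable
  have hp : ∀ k m, P.map (idx (D k)) {m} ≤ treeMeasure (E k m) := by
    intro k m
    rw [Measure.map_apply (measurable_idx (hD.pos k)) (measurableSet_singleton _)]
    rcases Set.eq_empty_or_nonempty (idx (D k) ⁻¹' {m} : Set X) with h | ⟨x, rfl⟩
    · simp [h]
    · have hx : idx (D k) (d (idx (D k) x)) = idx (D k) x := idx_denseSeq_idx (hD.pos k) x
      have hEq : E k (idx (D k) x) = pathSet D P k (d (idx (D k) x)) := by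
        ext ω
        exact and_iff_right hx
      rw [hEq]
      conv_lhs => rw [← hx]
      exact le_treeMeasure_pathSet hD P k _
  choose h hhm hmap _ hmem using fun k =>
    exists_selection treeMeasure (P.map (idx (D k))) (E k) (hE k) (hdisj k) (hp k)
  have hall : ∀ᵐ ω ∂treeMeasure, ∀ k, ω ∈ E k (h k ω) := ae_all_iff.2 hmem
  have hidx : ∀ ω, (∀ k, ω ∈ E k (h k ω)) → ∀ k l, k ≤ l →
      idx (D l) (d (h k ω)) = idx (D l) (d (h l ω)) := fun ω hω k l hkl =>
    idx_eq_of_mem_pathSet hD (pathSet_mono D P hkl _ (hω k).2) (hω l).2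
  have hlim : ∀ᵐ ω ∂treeMeasure, ∃ z, Tendsto (fun n : ℕ => d (h (-n) ω)) atTop (𝓝 z) := by
    filter_upwards [hall] with ω hω
    refine cauchySeq_tendsto_of_complete (Metric.cauchySeq_iff'.2 fun ε hε => ?_)
    obtain ⟨k, hk⟩ := hD.small ε hε
    refine ⟨(-k).toNat, fun n hn => ?_⟩
    have h1 := Int.self_le_toNat (-k)
    refine ((idx_eq_iff (hD.pos _)).1 (hidx ω hω _ _ ?_)).trans_lt
      ((hD.mono (by lia)).trans_lt hk)
    lia
  obtain ⟨f, hf, hft⟩ := measurable_limit_of_tendsto_metrizable_ae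
    (fun n : ℕ => ((measurable_from_nat (f := d)).comp (hhm (-n))).aemeasurable) hlim
  have hpath : ∀ᵐ ω ∂treeMeasure, ∀ k, ω ∈ pathSet D P k (f ω) := by
    filter_upwards [hall, hft] with ω hω hωf k
    have h1 := Int.self_le_toNat (-k)
    have hz : idx (D (-((-k).toNat : ℤ))) (f ω) =
        idx (D (-((-k).toNat : ℤ))) (d (h (-((-k).toNat : ℤ)) ω)) := by
      refine (idx_eq_iff (hD.pos _)).2 ?_
      refine le_of_tendsto (hωf.dist tendsto_const_nhds) ?_
      filter_upwards [eventually_ge_atTop (-k).toNat] with n hn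
      exact (idx_eq_iff (hD.pos _)).1 (hidx ω hω _ _ (by lia))
    refine pathSet_mono D P (k := -((-k).toNat : ℤ)) (by lia) _ ?_
    rw [pathSet_congr hD P hz]
    exact (hω _).2
  refine ⟨f, hf, ?_, hpath⟩
  have : IsProbabilityMeasure (treeMeasure.map f) :=
    Measure.isProbabilityMeasure_map hf.aemeasurable
  refine ext_of_map_idx hD fun k m => ?_
  have hm := measurable_idx (X := X) (hD.pos k)
  rw [← Measure.map_apply hm (measurableSet_singleton m), Measure.map_map hm hf,
    ← Measure.map_apply hm (measurableSet_singleton m), ← hmap k]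
  congr 1
  refine Measure.map_congr ?_
  filter_upwards [hall, hpath] with ω hω hωf
  rw [Function.comp_apply, idx_eq_of_mem_pathSet hD (hωf k) (hω k).2, (hω k).1]

/-- The `ℓ¹` distance between the laws of the ball of radius `r`. -/
def gap (P Q : Measure X) (r : ℝ) : ℝ≥0∞ := L1 (P.map (idx r)) (Q.map (idx r))

lemma gap_eq_tsum {r : ℝ} (hr : 0 < r) (P Q : Measure X) :
    gap P Q r = ∑' m, ‖P.real (idx r ⁻¹' {m}) - Q.real (idx r ⁻¹' {m})‖ₑ := by
  simp only [gap, L1, map_measureReal_apply (measurable_idx hr) (measurableSet_singleton _)]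

lemma tsum_tsum_inter_le_gap {r r' : ℝ} (hr : 0 < r) (hrr' : r ≤ r') (P Q : Measure X) :
    ∑' b, ∑' m, ‖P.real (idx r' ⁻¹' {b} ∩ idx r ⁻¹' {m}) -
      Q.real (idx r' ⁻¹' {b} ∩ idx r ⁻¹' {m})‖ₑ ≤ gap P Q r := by
  rw [ENNReal.tsum_comm, gap_eq_tsum hr]
  refine ENNReal.tsum_le_tsum fun m => ?_
  rcases Set.eq_empty_or_nonempty (idx r ⁻¹' {m} : Set X) with h | ⟨x, rfl⟩
  · simp [h]
  · rw [tsum_eq_single (idx r' x)]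
    · rw [Set.inter_eq_right.2]
      exact fun y hy => idx_eq_of_le hr hrr' hy
    · intro b hb
      have : (idx r' ⁻¹' {b} ∩ idx r ⁻¹' {idx r x} : Set X) = ∅ := by
        refine Set.eq_empty_of_forall_notMem fun y hy => hb ?_
        rw [← idx_eq_of_le hr hrr' hy.2]
        exact hy.1.symm
      simp [this]

lemma treeMeasure_split_le {D : ℤ → ℝ} (hD : IsScale D) (P Q : Measure X)
    [IsProbabilityMeasure P] [IsProbabilityMeasure Q] {f g : (ℤ × ℕ → ℕ → ℝ) → X}
    (hf : ∀ᵐ ω ∂treeMeasure, ∀ k, ω ∈ pathSet D P k (f ω))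
    (hg : ∀ᵐ ω ∂treeMeasure, ∀ k, ω ∈ pathSet D Q k (g ω)) (k : ℤ) :
    treeMeasure {ω | idx (D k) (f ω) ≠ idx (D k) (g ω) ∧
      idx (D (k + 1)) (f ω) = idx (D (k + 1)) (g ω)} ≤
      gap P Q (D k) + gap P Q (D (k + 1)) := by
  let A : ℕ → Set (ℕ → ℝ) := fun b => {v | sel (stepLaw D P k b) v ≠ sel (stepLaw D Q k b) v}
  have hA : ∀ b, MeasurableSet (A b) := fun b =>
    (measurableSet_eq_fun (measurable_sel _) (measurable_sel _)).compl
  let H : ℕ → Set (ℤ × ℕ → ℕ → ℝ) := fun b => {ω | ∃ x, idx (D (k + 1)) x = b ∧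
    ω ∈ pathSet D P (k + 1) x ∧ ω ∈ pathSet D Q (k + 1) x ∧ ω (k, b) ∈ A b}
  have hcover : treeMeasure {ω | idx (D k) (f ω) ≠ idx (D k) (g ω) ∧
      idx (D (k + 1)) (f ω) = idx (D (k + 1)) (g ω)} ≤ treeMeasure (⋃ b, H b) := by
    refine measure_mono_ae ?_
    filter_upwards [hf, hg] with ω hωf hωg hω
    refine Set.mem_iUnion.2 ⟨_, f ω, rfl, hωf _, ?_, ?_⟩
    · rw [pathSet_congr hD Q hω.2]
      exact hωg _
    · have h1 := hωf k 0
      have h2 := hωg k 0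
      simp only [stepSet, Set.mem_ofPred_eq, Nat.cast_zero, add_zero] at h1 h2
      rw [← hω.2] at h2
      simp only [A, Set.mem_ofPred_eq, h1, h2]
      exact hω.1
  have hH : ∀ b, treeMeasure (H b) ≤
      min (P (idx (D (k + 1)) ⁻¹' {b})) (Q (idx (D (k + 1)) ⁻¹' {b})) * raceMeasure (A b) := by
    intro b
    by_cases hb : ∃ x : X, idx (D (k + 1)) x = b
    · obtain ⟨x, rfl⟩ := hb
      rcases min_choice (P (idx (D (k + 1)) ⁻¹' {idx (D (k + 1)) x}))
        (Q (idx (D (k + 1)) ⁻¹' {idx (D (k + 1)) x})) with h | h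
      · rw [h]
        refine (measure_mono ?_).trans (treeMeasure_pathSet_inter_le hD P k x (hA _))
        rintro ω ⟨y, hy, h1, h2, h3⟩
        exact ⟨pathSet_congr hD P hy ▸ h1, h3⟩
      · rw [h]
        refine (measure_mono ?_).trans (treeMeasure_pathSet_inter_le hD Q k x (hA _))
        rintro ω ⟨y, hy, h1, h2, h3⟩
        exact ⟨pathSet_congr hD Q hy ▸ h2, h3⟩
    · have : H b = ∅ := Set.eq_empty_of_forall_notMem fun ω hω => hb ⟨hω.choose, hω.choose_spec.1⟩
      simp [this]
  calc _ ≤ treeMeasure (⋃ b, H b) := hcover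
    _ ≤ ∑' b, treeMeasure (H b) := measure_iUnion_le _
    _ ≤ ∑' b, (∑' m, ‖P.real (idx (D (k + 1)) ⁻¹' {b} ∩ idx (D k) ⁻¹' {m}) -
        Q.real (idx (D (k + 1)) ⁻¹' {b} ∩ idx (D k) ⁻¹' {m})‖ₑ +
        ‖P.real (idx (D (k + 1)) ⁻¹' {b}) - Q.real (idx (D (k + 1)) ⁻¹' {b})‖ₑ) :=
      ENNReal.tsum_le_tsum fun b => (hH b).trans (min_mul_raceMeasure_sel_ne_le P Q
        (measurable_idx (hD.pos _) (measurableSet_singleton _)) (measurable_idx (hD.pos _)))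
    _ ≤ _ := by
      rw [ENNReal.tsum_add, ← gap_eq_tsum (hD.pos _)]
      gcongr
      exact tsum_tsum_inter_le_gap (hD.pos _) (hD.mono (by lia)) P Q

lemma lintegral_dist_tree_le {D : ℤ → ℝ} (hD : IsScale D) (P Q : Measure X)
    [IsProbabilityMeasure P] [IsProbabilityMeasure Q] {f g : (ℤ × ℕ → ℕ → ℝ) → X}
    (hfm : Measurable f) (hgm : Measurable g)
    (hf : ∀ᵐ ω ∂treeMeasure, ∀ k, ω ∈ pathSet D P k (f ω))
    (hg : ∀ᵐ ω ∂treeMeasure, ∀ k, ω ∈ pathSet D Q k (g ω)) :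
    ∫⁻ ω, ENNReal.ofReal (dist (f ω) (g ω)) ∂treeMeasure ≤
      ∑' k, ENNReal.ofReal (D (k + 1)) * (gap P Q (D k) + gap P Q (D (k + 1))) := by
  let S : ℤ → Set (ℤ × ℕ → ℕ → ℝ) := fun k => {ω | idx (D k) (f ω) ≠ idx (D k) (g ω) ∧
      idx (D (k + 1)) (f ω) = idx (D (k + 1)) (g ω)}
  have hS : ∀ k, MeasurableSet (S k) := fun k =>
    MeasurableSet.inter
      (measurableSet_eq_fun ((measurable_idx (hD.pos _)).comp hfm)
        ((measurable_idx (hD.pos _)).comp hgm)).compl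
      (measurableSet_eq_fun ((measurable_idx (hD.pos _)).comp hfm)
        ((measurable_idx (hD.pos _)).comp hgm))
  calc _ ≤ ∫⁻ ω, ∑' k, (S k).indicator (fun _ => ENNReal.ofReal (D (k + 1))) ω ∂treeMeasure := by
        refine lintegral_mono fun ω => ?_
        by_cases h : f ω = g ω
        · simp [h]
        · obtain ⟨k, hk⟩ := exists_idx_ne_idx_succ_eq hD h
          refine le_trans ?_ (ENNReal.le_tsum k)
          rw [Set.indicator_of_mem (show ω ∈ S k from hk)]
          exact ENNReal.ofReal_le_ofReal ((idx_eq_iff (hD.pos _)).1 hk.2)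
    _ = ∑' k, ENNReal.ofReal (D (k + 1)) * treeMeasure (S k) := by
        rw [lintegral_tsum fun k => (measurable_const.indicator (hS k)).aemeasurable]
        simp only [lintegral_indicator_const (hS _)]
    _ ≤ _ := ENNReal.tsum_le_tsum fun k => by
        gcongr
        exact treeMeasure_split_le hD P Q hf hg k

lemma enorm_measureReal_sub_le {Ω : Type*} [MeasurableSpace Ω] (μ : Measure Ω)
    [IsFiniteMeasure μ] {U V N : Set Ω} (hN : MeasurableSet N) (h : U \ N = V \ N) :
    ‖μ.real U - μ.real V‖ₑ ≤ μ (U ∩ N) + μ (V ∩ N) := by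
  have h1 : ∀ s : Set Ω, ‖μ.real s‖ₑ = μ s := fun s => by
    rw [Real.enorm_of_nonneg measureReal_nonneg, ofReal_measureReal]
  have h2 : μ.real U - μ.real V = μ.real (U ∩ N) - μ.real (V ∩ N) := by
    rw [← measureReal_inter_add_sdiff (s := U) hN, ← measureReal_inter_add_sdiff (s := V) hN, h]
    ring
  rw [h2]
  exact enorm_sub_le.trans_eq (by rw [h1, h1])

lemma gap_le {r : ℝ} (hr : 0 < r) [SecondCountableTopology X] {P Q : Measure X}
    {γ : Measure (X × X)} [IsProbabilityMeasure γ] (hP : γ.map Prod.fst = P)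
    (hQ : γ.map Prod.snd = Q) : gap P Q r ≤ 2 * γ {z | r < dist z.1 z.2} := by
  have h1 : Measurable fun z : X × X => idx r z.1 := (measurable_idx hr).comp measurable_fst
  have h2 : Measurable fun z : X × X => idx r z.2 := (measurable_idx hr).comp measurable_snd
  have hN : MeasurableSet {z : X × X | r < dist z.1 z.2} :=
    measurableSet_lt measurable_const measurable_dist
  have hfst : ∀ m, P.real (idx r ⁻¹' {m}) = γ.real ((fun z => idx r z.1) ⁻¹' {m}) := fun m => by
    rw [← hP, map_measureReal_apply measurable_fst (measurable_idx hr (measurableSet_singleton m))]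
    rfl
  have hsnd : ∀ m, Q.real (idx r ⁻¹' {m}) = γ.real ((fun z => idx r z.2) ⁻¹' {m}) := fun m => by
    rw [← hQ, map_measureReal_apply measurable_snd (measurable_idx hr (measurableSet_singleton m))]
    rfl
  have hdiff : ∀ m, ((fun z : X × X => idx r z.1) ⁻¹' {m}) \ {z | r < dist z.1 z.2} =
      ((fun z => idx r z.2) ⁻¹' {m}) \ {z | r < dist z.1 z.2} := by
    intro m
    ext z
    simp only [Set.mem_sdiff, Set.mem_preimage, Set.mem_singleton_iff, Set.mem_ofPred_eq, not_lt,
      and_congr_left_iff]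
    intro hz
    rw [(idx_eq_iff hr).2 hz]
  rw [gap_eq_tsum hr]
  simp only [hfst, hsnd]
  calc _ ≤ ∑' m, (γ (((fun z : X × X => idx r z.1) ⁻¹' {m}) ∩ {z | r < dist z.1 z.2}) +
        γ (((fun z => idx r z.2) ⁻¹' {m}) ∩ {z | r < dist z.1 z.2})) :=
      ENNReal.tsum_le_tsum fun m => enorm_measureReal_sub_le γ hN (hdiff m)
    _ = _ := by
      rw [ENNReal.tsum_add]
      simp only [Set.inter_comm _ {z : X × X | r < dist z.1 z.2}]
      rw [tsum_measure_inter_preimage_singleton _ hN h1,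
        tsum_measure_inter_preimage_singleton _ hN h2, two_mul]

lemma tsum_indicator_sub_le {D : ℤ → ℝ} (hD : IsScale D) {d : ℝ} :
    ∑' j, (if D j < d then ENNReal.ofReal (D j - D (j - 1)) else 0) ≤ ENNReal.ofReal d := by
  let s : ℤ → Set ℝ := fun j => if D j < d then Set.Ioc (D (j - 1)) (D j) else ∅
  have hs : ∀ j, (if D j < d then ENNReal.ofReal (D j - D (j - 1)) else 0) = volume (s j) := by
    intro j
    simp only [s]
    split_ifs <;> simp
  have hsub : ∀ j, s j ⊆ Set.Ioc (D (j - 1)) (D j) := by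
    intro j
    simp only [s]
    split_ifs <;> simp
  have hsm : ∀ j, MeasurableSet (s j) := by
    intro j
    simp only [s]
    split_ifs <;> measurability
  have hd : Pairwise (Function.onFun Disjoint s) := fun i j hij =>
    (hD.mono.pairwise_disjoint_on_Ioc_pred hij).mono (hsub i) (hsub j)
  simp only [hs]
  rw [← measure_iUnion hd hsm]
  calc _ ≤ volume (Set.Ioc 0 d) := measure_mono <| Set.iUnion_subset fun j x hx => by
        have h1 := hsub j hx
        simp only [s] at hx
        split_ifs at hx with h
        · exact ⟨(hD.pos _).trans h1.1, h1.2.trans h.le⟩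
        · exact hx.elim
    _ = _ := by simp

lemma tsum_gap_le {D : ℤ → ℝ} (hD : IsScale D) [SecondCountableTopology X] (P Q : Measure X) :
    ∑' j, ENNReal.ofReal (D j - D (j - 1)) * gap P Q (D j) ≤
      2 * Cstar (fun x y => dist x y) P Q := by
  unfold Cstar
  simp only [ENNReal.mul_iInf_of_ne two_ne_zero ofNat_ne_top]
  refine le_iInf₂ fun γ hγ => ?_
  obtain ⟨h0, hP, hQ⟩ := hγ
  have hN : ∀ j, MeasurableSet {z : X × X | D j < dist z.1 z.2} := fun j =>
    measurableSet_lt measurable_const measurable_dist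
  calc _ ≤ ∑' j, 2 * (ENNReal.ofReal (D j - D (j - 1)) * γ {z | D j < dist z.1 z.2}) :=
        ENNReal.tsum_le_tsum fun j => by
          rw [mul_left_comm]
          gcongr
          exact gap_le (hD.pos j) hP hQ
    _ = 2 * ∫⁻ z, ∑' j, (if D j < dist z.1 z.2 then ENNReal.ofReal (D j - D (j - 1)) else 0) ∂γ := by
        rw [ENNReal.tsum_mul_left, lintegral_tsum]
        · congr 2 with j
          rw [← lintegral_indicator_const (hN j)]
          rfl
        · exact fun j => (Measurable.ite (hN j) measurable_const measurable_const).aemeasurable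
    _ ≤ _ := by
        gcongr
        exact tsum_indicator_sub_le hD

lemma isScale_zpow {a : ℝ} (ha : 1 < a) {n : ℕ} (hn : n ≠ 0) (s : ℤ) :
    IsScale fun k => a ^ ((n : ℤ) * k + s) := by
  have h0 : 0 < a := one_pos.trans ha
  have hn' : (0 : ℤ) < n := by positivity
  refine ⟨fun k => zpow_pos h0 _, fun k l hkl => zpow_le_zpow_right₀ ha.le (by gcongr), ?_, ?_⟩
  · intro ε hε
    obtain ⟨m, hm⟩ := exists_pow_lt_of_lt_one hε (inv_lt_one_of_one_lt₀ ha)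
    refine ⟨-(m + |s|), lt_of_le_of_lt ?_ hm⟩
    rw [inv_pow, ← zpow_natCast, ← zpow_neg]
    refine zpow_le_zpow_right₀ ha.le ?_
    have := le_abs_self s
    nlinarith [abs_nonneg s]
  · intro R
    obtain ⟨m, hm⟩ := pow_unbounded_of_one_lt R ha
    refine ⟨m + |s|, hm.le.trans ?_⟩
    rw [← zpow_natCast]
    refine zpow_le_zpow_right₀ ha.le ?_
    have := neg_le_abs s
    nlinarith [abs_nonneg s]

lemma tsum_zpow_mul_gap_le [SecondCountableTopology X] (P Q : Measure X) :
    ∑' j : ℤ, ENNReal.ofReal ((11 / 10) ^ j) * gap P Q ((11 / 10) ^ j) ≤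
      22 * Cstar (fun x y => dist x y) P Q := by
  have hD := isScale_zpow (a := 11 / 10) (by norm_num) one_ne_zero 0
  have h := tsum_gap_le hD P Q
  simp only [Nat.cast_one, one_mul, add_zero] at h
  have hj : ∀ j : ℤ, ENNReal.ofReal ((11 / 10) ^ j) =
      11 * ENNReal.ofReal ((11 / 10) ^ j - (11 / 10) ^ (j - 1)) := by
    intro j
    rw [← ENNReal.ofReal_ofNat 11, ← ENNReal.ofReal_mul (by norm_num),
      zpow_sub_one₀ (by norm_num)]
    congr 1
    ring
  simp only [hj, mul_assoc]
  rw [ENNReal.tsum_mul_left]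
  calc _ ≤ 11 * (2 * Cstar (fun x y => dist x y) P Q) := by
        gcongr
    _ = _ := by
        rw [← mul_assoc]
        norm_num

end Ultrametric

lemma exists_stdSpace_map_eq {Y : Type*} [MeasurableSpace Y] [StandardBorelSpace Y] [Nonempty Y]
    (μ : Measure Y) [IsProbabilityMeasure μ] :
    ∃ φ : ℝ → Y, Measurable φ ∧ stdSpace.map φ = μ := by
  obtain ⟨φ, hφ, hμ⟩ := Measure.exists_measurable_map_eq μ
  have hproj : Measurable (Set.projIcc (0 : ℝ) 1 zero_le_one) := continuous_projIcc.measurable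
  refine ⟨φ ∘ Set.projIcc 0 1 zero_le_one, hφ.comp hproj, ?_⟩
  rw [← Measure.map_map hφ hproj, ← hμ]
  congr 1
  rw [stdSpace, ← map_comap_subtype_coe measurableSet_Icc,
    Measure.map_map hproj measurable_subtype_coe]
  have : Set.projIcc (0 : ℝ) 1 zero_le_one ∘ Subtype.val = id := by
    ext x
    simp
  rw [this, Measure.map_id]
  rfl

/-- The uniform distribution on `Fin 13`. -/
def uniformFin : Measure (Fin 13) := (13 : ℝ≥0∞)⁻¹ • Measure.count

instance : IsProbabilityMeasure uniformFin :=
  ⟨by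
    simp only [uniformFin, Measure.smul_apply, smul_eq_mul, Measure.count_univ]
    simp [ENNReal.inv_mul_cancel]⟩

lemma lintegral_uniformFin_prod {Ω : Type*} [MeasurableSpace Ω] (μ : Measure Ω) [SFinite μ]
    {F : Fin 13 × Ω → ℝ≥0∞} (hF : Measurable F) :
    ∫⁻ z, F z ∂(uniformFin.prod μ) = 13⁻¹ * ∑ s, ∫⁻ ω, F (s, ω) ∂μ := by
  rw [lintegral_prod _ hF.aemeasurable, uniformFin, lintegral_smul_measure, lintegral_count,
    tsum_fintype, smul_eq_mul]

lemma map_uniformFin_prod {Ω X : Type*} [MeasurableSpace Ω] [MeasurableSpace X] (μ : Measure Ω)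
    [SFinite μ] {P : Measure X} {f : Fin 13 → Ω → X} (hf : ∀ s, Measurable (f s))
    (hP : ∀ s, μ.map (f s) = P) :
    (uniformFin.prod μ).map (fun z => f z.1 z.2) = P := by
  have hF : Measurable fun z : Fin 13 × Ω => f z.1 z.2 := measurable_from_prod_countable_right hf
  ext s hs
  rw [← lintegral_indicator_one hs, lintegral_map (measurable_one.indicator hs) hF,
    lintegral_uniformFin_prod μ (F := fun z => s.indicator 1 (f z.1 z.2))
      ((measurable_one.indicator hs).comp hF)]
  have : ∀ i, ∫⁻ ω, s.indicator 1 (f i ω) ∂μ = P s := fun i => by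
    rw [← lintegral_map (measurable_one.indicator hs) (hf i), hP, lintegral_indicator_one hs]
  simp only [this, Finset.sum_const, Finset.card_univ, Fintype.card_fin, nsmul_eq_mul]
  rw [← mul_assoc, Nat.cast_ofNat, ENNReal.inv_mul_cancel (by norm_num) (by norm_num), one_mul]

lemma sum_tsum_zpow_eq (G : ℝ → ℝ≥0∞) :
    ∑ s : Fin 13, ∑' k : ℤ, ENNReal.ofReal ((11 / 10) ^ (13 * (k + 1) + (s : ℤ))) *
      (G ((11 / 10) ^ (13 * k + (s : ℤ))) + G ((11 / 10) ^ (13 * (k + 1) + (s : ℤ)))) =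
    (ENNReal.ofReal ((11 / 10) ^ 13) + 1) *
      ∑' j : ℤ, ENNReal.ofReal ((11 / 10) ^ j) * G ((11 / 10) ^ j) := by
  let T : ℤ → ℝ≥0∞ := fun j => ENNReal.ofReal ((11 / 10) ^ j) * G ((11 / 10) ^ j)
  have hT : ∑ s : Fin 13, ∑' k : ℤ, T (13 * k + (s : ℤ)) = ∑' j, T j := by
    rw [← (Int.divModEquiv 13).symm.tsum_eq T,
      ENNReal.tsum_prod (f := fun k s => T ((Int.divModEquiv 13).symm (k, s))),
      ENNReal.tsum_comm, tsum_fintype]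
    simp only [Int.divModEquiv_symm_apply, Nat.cast_ofNat, mul_comm]
  have hshift : ∀ s : Fin 13,
      ∑' k : ℤ, T (13 * (k + 1) + (s : ℤ)) = ∑' k : ℤ, T (13 * k + (s : ℤ)) :=
    fun s => (Equiv.addRight (1 : ℤ)).tsum_eq fun k => T (13 * k + (s : ℤ))
  have hterm : ∀ (s : Fin 13) (k : ℤ), ENNReal.ofReal ((11 / 10) ^ (13 * (k + 1) + (s : ℤ))) *
      (G ((11 / 10) ^ (13 * k + (s : ℤ))) + G ((11 / 10) ^ (13 * (k + 1) + (s : ℤ)))) =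
      ENNReal.ofReal ((11 / 10) ^ 13) * T (13 * k + (s : ℤ)) + T (13 * (k + 1) + (s : ℤ)) := by
    intro s k
    have hexp : 13 * (k + 1) + (s : ℤ) = (13 : ℕ) + (13 * k + s) := by
      push_cast
      ring
    rw [mul_add]
    congr 1
    rw [hexp, zpow_add₀ (by norm_num), zpow_natCast, ENNReal.ofReal_mul (by positivity), mul_assoc]
  simp only [hterm, ENNReal.tsum_add, ENNReal.tsum_mul_left, hshift]
  rw [Finset.sum_add_distrib, ← Finset.mul_sum, hT, add_mul, one_mul]

lemma exists_coupling_cost_le {X : Type*} [MetricSpace X] [CompleteSpace X]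
    [TopologicalSpace.SeparableSpace X] [Nonempty X] [IsUltrametricDist X] [MeasurableSpace X]
    [BorelSpace X] :
    ∃ f : ProbabilityMeasure X → ℝ → X,
      IsCoupling (fun P : ProbabilityMeasure X => (P : Measure X)) f ∧
      ∀ P Q, ∫⁻ u, ENNReal.ofReal (dist (f P u) (f Q u)) ∂stdSpace ≤
        ENNReal.ofReal (22 * (1 + (11 / 10) ^ 13) / 13) *
          Cstar (fun x y => dist x y) (P : Measure X) (Q : Measure X) := by
  have : SecondCountableTopology X := UniformSpace.secondCountable_of_separable X
  obtain ⟨D, hDs, hD⟩ : ∃ D : Fin 13 → ℤ → ℝ,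
      (∀ s k, D s k = (11 / 10) ^ (13 * k + (s : ℤ))) ∧ ∀ s, IsScale (D s) :=
    ⟨fun s k => (11 / 10) ^ (13 * k + (s : ℤ)), fun _ _ => rfl,
      fun s => isScale_zpow (by norm_num) (n := 13) (by norm_num) s⟩
  choose F hFm hFP hFpath using fun (s : Fin 13) (P : ProbabilityMeasure X) =>
    exists_tree_map (hD s) (P : Measure X)
  obtain ⟨φ, hφ, hφμ⟩ := exists_stdSpace_map_eq (uniformFin.prod treeMeasure)
  have hm : ∀ P, Measurable fun z : Fin 13 × (ℤ × ℕ → ℕ → ℝ) => F z.1 P z.2 := fun P =>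
    measurable_from_prod_countable_right fun s => hFm s P
  refine ⟨fun P u => F (φ u).1 P (φ u).2, ⟨fun P => (hm P).comp hφ, fun P => ?_⟩, fun P Q => ?_⟩
  · have h := map_uniformFin_prod treeMeasure (fun s => hFm s P) (fun s => hFP s P)
    rwa [← hφμ, Measure.map_map (hm P) hφ] at h
  · have hdist : Measurable fun z : Fin 13 × (ℤ × ℕ → ℕ → ℝ) =>
        ENNReal.ofReal (dist (F z.1 P z.2) (F z.1 Q z.2)) := ((hm P).dist (hm Q)).ennreal_ofReal
    have h13 : ENNReal.ofReal (22 * (1 + (11 / 10) ^ 13) / 13) =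
        13⁻¹ * ((ENNReal.ofReal ((11 / 10) ^ 13) + 1) * 22) := by
      rw [← ENNReal.ofReal_one, ← ENNReal.ofReal_add (by positivity) zero_le_one,
        ← ENNReal.ofReal_ofNat 22, ← ENNReal.ofReal_mul (by positivity),
        ← ENNReal.ofReal_ofNat 13, ← ENNReal.ofReal_inv_of_pos (by norm_num),
        ← ENNReal.ofReal_mul (by positivity)]
      congr 1
      ring
    have htree : ∑ s, ∫⁻ ω, ENNReal.ofReal (dist (F s P ω) (F s Q ω)) ∂treeMeasure ≤
        (ENNReal.ofReal ((11 / 10) ^ 13) + 1) *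
          ∑' j : ℤ, ENNReal.ofReal ((11 / 10) ^ j) * gap (P : Measure X) Q ((11 / 10) ^ j) := by
      rw [← sum_tsum_zpow_eq (gap (P : Measure X) Q)]
      refine Finset.sum_le_sum fun s _ => ?_
      have h := lintegral_dist_tree_le (hD s) (P : Measure X) (Q : Measure X) (f := F s P)
        (g := F s Q) (hFm s P) (hFm s Q) (hFpath s P) (hFpath s Q)
      simpa only [hDs] using h
    calc _ = ∫⁻ z, ENNReal.ofReal (dist (F z.1 P z.2) (F z.1 Q z.2))
          ∂(uniformFin.prod treeMeasure) := by rw [← hφμ, lintegral_map hdist hφ]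
      _ = 13⁻¹ * ∑ s, ∫⁻ ω, ENNReal.ofReal (dist (F s P ω) (F s Q ω)) ∂treeMeasure :=
          lintegral_uniformFin_prod treeMeasure hdist
      _ ≤ 13⁻¹ * ((ENNReal.ofReal ((11 / 10) ^ 13) + 1) *
          ∑' j : ℤ, ENNReal.ofReal ((11 / 10) ^ j) * gap (P : Measure X) Q ((11 / 10) ^ j)) := by
        gcongr
      _ ≤ 13⁻¹ * ((ENNReal.ofReal ((11 / 10) ^ 13) + 1) *
          (22 * Cstar (fun x y => dist x y) (P : Measure X) Q)) := by
        gcongr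
        exact tsum_zpow_mul_gap_le _ _
      _ = _ := by rw [h13]; ring

/-- for a complete separable metric space `(X, c)` with at least two
points whose metric `c` is an ultrametric, the optimal pairwise coupling ratio of the
family of all Borel probability measures on `X` (with cost `c`) satisfies
`r*_c(P(X)) < 7.56`. -/
theorem ultrametric_optRatio_lt {X : Type*} [MetricSpace X] [CompleteSpace X]
    [TopologicalSpace.SeparableSpace X] [Nontrivial X] [MeasurableSpace X] [BorelSpace X]
    (hult : ∀ x y z : X, dist x z ≤ max (dist x y) (dist y z)) :
    optRatio (fun x y : X => dist x y)
        (fun P : ProbabilityMeasure X => (P : Measure X))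
      < ENNReal.ofReal 7.56 := by
  have : IsUltrametricDist X := ⟨hult⟩
  obtain ⟨f, hf, hcost⟩ := exists_coupling_cost_le (X := X)
  have h1 : couplingRatio (fun x y : X => dist x y)
      (fun P : ProbabilityMeasure X => (P : Measure X)) f ≤
      ENNReal.ofReal (22 * (1 + (11 / 10) ^ 13) / 13) :=
    sInf_le ⟨by rw [ENNReal.one_le_ofReal]; norm_num, hcost⟩
  refine ((iInf₂_le f hf).trans h1).trans_lt ?_
  rw [ENNReal.ofReal_lt_ofReal_iff (by norm_num)]
  norm_num

end
end

section
/- Let (X,c) be a complete separable metric space with at least two points (so that the metric c is a symmetric cost function), and let {P_α}_{α∈A} be a finite family of Borel probability measures on X with |A| ≥ 2. Then r*_c({P_α}_{α∈A}) < 23.1·log|A|, where log denotes the natural logarithm. -/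
open MeasureTheory ENNReal

noncomputable section

open ProbabilityTheory Function

section Transport

variable {X : Type*} [MeasurableSpace X]

/-- `γ` is a transport plan between `P` and `Q`. -/
structure IsPlan (P Q : Measure X) (γ : Measure (X × X)) : Prop where
  prob : IsProbabilityMeasure γ
  map_fst : γ.map Prod.fst = P
  map_snd : γ.map Prod.snd = Q

theorem IsPlan.swap {P Q : Measure X} {γ : Measure (X × X)} (h : IsPlan P Q γ) :
    IsPlan Q P (γ.map Prod.swap) where
  prob := by
    have := h.prob
    exact Measure.isProbabilityMeasure_map measurable_swap.aemeasurable
  map_fst := by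
    rw [Measure.map_map measurable_fst measurable_swap]
    exact h.map_snd
  map_snd := by
    rw [Measure.map_map measurable_snd measurable_swap]
    exact h.map_fst

theorem isPlan_diag (P : Measure X) [IsProbabilityMeasure P] :
    IsPlan P P (P.map fun x => (x, x)) where
  prob := Measure.isProbabilityMeasure_map (by fun_prop)
  map_fst := by
    rw [Measure.map_map measurable_fst (by fun_prop)]
    exact Measure.map_id
  map_snd := by
    rw [Measure.map_map measurable_snd (by fun_prop)]
    exact Measure.map_id

variable [MetricSpace X]

/-- The transport cost for the metric cost. -/
abbrev wass (P Q : Measure X) : ℝ≥0∞ := Cstar (fun x y : X => dist x y) P Q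

theorem wass_le {P Q : Measure X} {γ : Measure (X × X)} (h : IsPlan P Q γ) :
    wass P Q ≤ ∫⁻ z, edist z.1 z.2 ∂γ := by
  simp only [edist_dist]
  exact iInf₂_le γ ⟨h.prob, h.map_fst, h.map_snd⟩

theorem exists_plan_of_wass_lt {P Q : Measure X} {t : ℝ≥0∞} (h : wass P Q < t) :
    ∃ γ, IsPlan P Q γ ∧ ∫⁻ z, edist z.1 z.2 ∂γ < t := by
  simp only [wass, Cstar, iInf_lt_iff] at h
  obtain ⟨γ, hγ, hlt⟩ := h
  refine ⟨γ, ⟨hγ.1, hγ.2.1, hγ.2.2⟩, ?_⟩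
  simpa only [edist_dist] using hlt

variable [SecondCountableTopology X] [BorelSpace X]

theorem lintegral_edist_diag (P : Measure X) :
    ∫⁻ z, edist z.1 z.2 ∂(P.map fun x : X => (x, x)) = 0 := by
  rw [lintegral_map (by fun_prop) (by fun_prop)]
  simp

theorem wass_self (P : Measure X) [IsProbabilityMeasure P] : wass P P = 0 :=
  le_antisymm ((wass_le (isPlan_diag P)).trans_eq (lintegral_edist_diag P)) zero_le

theorem wass_comm_le (P Q : Measure X) : wass Q P ≤ wass P Q := by
  refine le_of_forall_gt fun t ht => ?_
  obtain ⟨γ, hγ, hlt⟩ := exists_plan_of_wass_lt ht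
  refine (wass_le hγ.swap).trans_lt ?_
  rw [lintegral_map (by fun_prop) measurable_swap]
  simpa only [Prod.fst_swap, Prod.snd_swap, edist_comm] using hlt

theorem wass_comm (P Q : Measure X) : wass P Q = wass Q P :=
  le_antisymm (wass_comm_le Q P) (wass_comm_le P Q)

theorem levyProkhorovEDist_le_of_wass_eq_zero {P Q : Measure X} [IsProbabilityMeasure P]
    [IsProbabilityMeasure Q] (h : wass P Q = 0) (ε : ℝ≥0∞) (hε : 0 < ε) (hε' : ε < ∞)
    (B : Set X) (hB : MeasurableSet B) : P B ≤ Q (Metric.thickening ε.toReal B) + ε := by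
  obtain ⟨γ, hγ, hlt⟩ := exists_plan_of_wass_lt (P := P) (Q := Q) (t := ε * ε)
    (by rw [h]; exact ENNReal.mul_pos hε.ne' hε.ne')
  have hfar : γ {z | ε ≤ edist z.1 z.2} ≤ ε := by
    have := mul_meas_ge_le_lintegral (μ := γ) (f := fun z : X × X => edist z.1 z.2)
      (by fun_prop) ε
    exact (ENNReal.mul_le_mul_iff_right hε.ne' hε'.ne).1 (this.trans hlt.le)
  rw [← hγ.map_fst, ← hγ.map_snd, Measure.map_apply measurable_fst hB,
    Measure.map_apply measurable_snd Metric.isOpen_thickening.measurableSet]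
  refine (measure_mono ?_).trans ((measure_union_le _ _).trans (add_le_add_right hfar _))
  intro z hz
  by_cases hd : ε ≤ edist z.1 z.2
  · exact Or.inr hd
  · left
    rw [Set.mem_preimage, Metric.mem_thickening_iff]
    refine ⟨z.1, hz, ?_⟩
    rw [not_le, edist_dist, ENNReal.ofReal_lt_iff_lt_toReal dist_nonneg hε'.ne] at hd
    rwa [dist_comm]

theorem eq_of_wass_eq_zero {P Q : Measure X} [IsProbabilityMeasure P]
    [IsProbabilityMeasure Q] (h : wass P Q = 0) : P = Q := by
  have hLP : levyProkhorovEDist P Q = 0 := by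
    refine le_antisymm (levyProkhorovEDist_le_of_forall_le P Q 0 fun ε B h0 h1 hB => ?_) zero_le
    exact levyProkhorovEDist_le_of_wass_eq_zero h ε h0 h1 B hB
  refine ext_of_generate_finite _ ((borel_eq_generateFrom_isClosed (α := X)) ▸
    BorelSpace.measurable_eq) isPiSystem_isClosed (fun F hF => ?_) (by simp)
  exact measure_eq_measure_of_levyProkhorovEDist_eq_zero_of_isClosed hLP hF
    ⟨1, one_pos, measure_ne_top _ _⟩ ⟨1, one_pos, measure_ne_top _ _⟩

theorem exists_plan_near_optimal (P Q : Measure X) [IsProbabilityMeasure P]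
    [IsProbabilityMeasure Q] {ε : ℝ} (hε : 0 < ε) :
    ∃ γ, IsPlan P Q γ ∧ ∫⁻ z, edist z.1 z.2 ∂γ ≤ ENNReal.ofReal (1 + ε) * wass P Q := by
  have h1 : 1 < ENNReal.ofReal (1 + ε) := by simpa using hε
  rcases eq_or_ne (wass P Q) 0 with h0 | h0
  · obtain rfl := eq_of_wass_eq_zero h0
    exact ⟨_, isPlan_diag P, (lintegral_edist_diag P).le.trans zero_le⟩
  · rcases eq_or_ne (wass P Q) ∞ with ht | ht
    · refine ⟨P.prod Q, ⟨inferInstance, by simp, by simp⟩, ?_⟩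
      rw [ht, ENNReal.mul_top (zero_lt_one.trans h1).ne']
      exact le_top
    · obtain ⟨γ, hγ, hlt⟩ := exists_plan_of_wass_lt (P := P) (Q := Q)
        (t := ENNReal.ofReal (1 + ε) * wass P Q) (by
          simpa using ENNReal.mul_lt_mul_left h0 ht h1)
      exact ⟨γ, hγ, hlt.le⟩

variable [CompleteSpace X]

/-- A transport plan is realised by moving each point with an independent uniform variable. -/
theorem IsPlan.exists_transfer {P Q : Measure X} {γ : Measure (X × X)} (h : IsPlan P Q γ) :
    ∃ f : X → unitInterval → X, Measurable (uncurry f) ∧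
      (P.prod (volume : Measure unitInterval)).map (fun z => (z.1, f z.1 z.2)) = γ := by
  have := h.prob
  have : Nonempty X := by
    obtain ⟨z⟩ := γ.nonempty_of_neZero
    exact ⟨z.1⟩
  obtain ⟨f, hf, hfγ⟩ := γ.condKernel.exists_measurable_map_eq_unitInterval
  have hP : γ.fst = P := h.map_fst
  have hPprob : IsProbabilityMeasure P := hP ▸ inferInstance
  refine ⟨f, hf, ?_⟩
  have hm : Measurable fun z : X × unitInterval => (z.1, f z.1 z.2) := by fun_prop
  conv_rhs => rw [← γ.disintegrate γ.condKernel, hP]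
  ext s hs
  rw [Measure.map_apply hm hs, Measure.prod_apply (hm hs), Measure.compProd_apply hs]
  refine lintegral_congr fun x => ?_
  rw [← hfγ, Measure.map_apply (by fun_prop) (measurable_prodMk_left hs)]
  rfl

theorem wass_triangle (P Q R : Measure X) : wass P R ≤ wass P Q + wass Q R := by
  refine ENNReal.le_of_forall_pos_le_add fun ε hε hlt => ?_
  obtain ⟨hPQ, hQR⟩ := ENNReal.add_lt_top.1 hlt
  have hε2 : (0 : ℝ≥0∞) < ε / 2 := ENNReal.half_pos (by simpa using hε.ne')
  obtain ⟨γ, hγ, hγlt⟩ := exists_plan_of_wass_lt (ENNReal.lt_add_right hPQ.ne hε2.ne')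
  obtain ⟨η, hη, hηlt⟩ := exists_plan_of_wass_lt (ENNReal.lt_add_right hQR.ne hε2.ne')
  obtain ⟨f, hf, hfη⟩ := hη.exists_transfer
  have := hγ.prob
  set ν := γ.prod (volume : Measure unitInterval)
  have hQν : ν.map (fun z => (z.1.2, f z.1.2 z.2)) = η := by
    rw [← hfη, ← hγ.map_snd]
    have := Measure.map_prod_map γ (volume : Measure unitInterval) measurable_snd measurable_id
    rw [Measure.map_id] at this
    rw [this, Measure.map_map (by fun_prop) (by fun_prop)]
    rfl
  have hg : Measurable fun z : (X × X) × unitInterval => (z.1.1, f z.1.2 z.2) := by fun_prop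
  have hplan : IsPlan P R (ν.map fun z => (z.1.1, f z.1.2 z.2)) := by
    refine ⟨Measure.isProbabilityMeasure_map hg.aemeasurable, ?_, ?_⟩
    · rw [Measure.map_map measurable_fst hg]
      change ν.map (Prod.fst ∘ Prod.fst) = P
      rw [← Measure.map_map measurable_fst measurable_fst, Measure.map_fst_prod]
      simp [hγ.map_fst]
    · rw [Measure.map_map measurable_snd hg, ← hη.map_snd, ← hQν,
        Measure.map_map measurable_snd (by fun_prop)]
      rfl
  refine (wass_le hplan).trans ?_
  rw [lintegral_map (by fun_prop) hg]
  calc ∫⁻ z, edist z.1.1 (f z.1.2 z.2) ∂ν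
      ≤ ∫⁻ z, (edist z.1.1 z.1.2 + edist z.1.2 (f z.1.2 z.2)) ∂ν :=
        lintegral_mono fun z => edist_triangle _ _ _
    _ = ∫⁻ z, edist z.1.1 z.1.2 ∂ν + ∫⁻ z, edist z.1.2 (f z.1.2 z.2) ∂ν :=
        lintegral_add_left (by fun_prop) _
    _ = ∫⁻ z, edist z.1 z.2 ∂γ + ∫⁻ z, edist z.1 z.2 ∂η := by
        congr 1
        · rw [lintegral_prod _ (by fun_prop)]
          simp
        · rw [← hQν, lintegral_map (by fun_prop) (by fun_prop)]
    _ ≤ (wass P Q + ε / 2) + (wass Q R + ε / 2) := add_le_add hγlt.le hηlt.le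
    _ = wass P Q + wass Q R + ε := by
        rw [add_add_add_comm, ENNReal.add_halves]

end Transport

section Couplings

variable {X ι A : Type*} [MetricSpace X] [MeasurableSpace X]

/-- The family `Q` has a joint law whose pairwise expected distances are at most `D`. -/
def HasCoupling (Q : ι → Measure X) (D : ι → ι → ℝ≥0∞) : Prop :=
  ∃ μ : Measure (ι → X), IsProbabilityMeasure μ ∧ (∀ i, μ.map (fun x => x i) = Q i) ∧
    ∀ i j, ∫⁻ x, edist (x i) (x j) ∂μ ≤ D i j

theorem HasCoupling.mono {Q : ι → Measure X} {D D' : ι → ι → ℝ≥0∞} (h : HasCoupling Q D)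
    (hD : ∀ i j, D i j ≤ D' i j) : HasCoupling Q D' := by
  obtain ⟨μ, h1, h2, h3⟩ := h
  exact ⟨μ, h1, h2, fun i j => (h3 i j).trans (hD i j)⟩

theorem HasCoupling.convex_comb {Q : ι → Measure X} {D D' : ι → ι → ℝ≥0∞}
    (h : HasCoupling Q D) (h' : HasCoupling Q D') {a b : ℝ≥0∞} (hab : a + b = 1) :
    HasCoupling Q fun i j => a * D i j + b * D' i j := by
  obtain ⟨μ, h1, h2, h3⟩ := h
  obtain ⟨ν, g1, g2, g3⟩ := h'
  refine ⟨a • μ + b • ν, ⟨by simp [hab]⟩, fun i => ?_, fun i j => ?_⟩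
  · rw [Measure.map_add _ _ (by fun_prop), Measure.map_smul, Measure.map_smul, h2, g2,
      ← add_smul, hab, one_smul]
  · rw [lintegral_add_measure, lintegral_smul_measure, lintegral_smul_measure]
    exact add_le_add (mul_le_mul_right (h3 i j) a) (mul_le_mul_right (g3 i j) b)

theorem HasCoupling.comap [SecondCountableTopology X] [BorelSpace X]
    {Q : ι → Measure X} {D : ι → ι → ℝ≥0∞} (h : HasCoupling Q D) (σ : A → ι) :
    HasCoupling (fun a => Q (σ a)) fun a b => D (σ a) (σ b) := by
  obtain ⟨μ, h1, h2, h3⟩ := h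
  have hm : Measurable fun (x : ι → X) a => x (σ a) := by fun_prop
  refine ⟨μ.map fun x a => x (σ a), Measure.isProbabilityMeasure_map hm.aemeasurable,
    fun a => ?_, fun a b => ?_⟩
  · rw [Measure.map_map (by fun_prop) hm]
    exact h2 (σ a)
  · rw [lintegral_map (by fun_prop) hm]
    exact h3 _ _

theorem hasCoupling_independent [SecondCountableTopology X] [BorelSpace X] [Fintype ι]
    [DecidableEq ι] (Q : ι → Measure X) [∀ i, IsProbabilityMeasure (Q i)] :
    HasCoupling Q fun i j => if i = j then 0 else ∞ := by
  refine ⟨Measure.pi Q, inferInstance, fun i => ?_, fun i j => ?_⟩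
  · have := Measure.pi_map_eval Q i
    simpa using this
  · beta_reduce
    split_ifs with h
    · simp [h]
    · exact le_top

variable [SecondCountableTopology X] [BorelSpace X] [CompleteSpace X]

/-- Moving every coordinate along near-optimal transport plans, with the same randomness for
coordinates that start and end with the same labels. -/
theorem HasCoupling.move [Countable ι] {P : A → Measure X} [∀ a, IsProbabilityMeasure (P a)]
    {ε : ℝ} (hε : 0 < ε) {σ σ' : ι → A} {D : ι → ι → ℝ≥0∞}
    (h : HasCoupling (fun i => P (σ i)) D) :
    ∃ D', HasCoupling (fun i => P (σ' i)) D' ∧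
      (∀ i j, σ i = σ j → σ' i = σ' j → D i j = 0 → D' i j = 0) ∧
      ∀ i j, D' i j ≤ D i j + ENNReal.ofReal (1 + ε) *
        (wass (P (σ i)) (P (σ' i)) + wass (P (σ j)) (P (σ' j))) := by
  obtain ⟨μ, hμ, hmarg, hcost⟩ := h
  choose γ hγ hγcost using fun a b => exists_plan_near_optimal (P a) (P b) hε
  choose f hf hfγ using fun a b => (hγ a b).exists_transfer
  set ν := μ.prod (volume : Measure unitInterval) with hν
  set F : (ι → X) × unitInterval → ι → X := fun z i => f (σ i) (σ' i) (z.1 i) z.2 with hF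
  have hFm : Measurable F := by
    refine measurable_pi_lambda _ fun i => ?_
    exact (hf (σ i) (σ' i)).comp (by fun_prop : Measurable fun z : (ι → X) × unitInterval => (z.1 i, z.2))
  have hFi : ∀ i, Measurable fun z => F z i := fun i => (measurable_pi_apply i).comp hFm
  have hlaw : ∀ i, ν.map (fun z => (z.1 i, F z i)) = γ (σ i) (σ' i) := by
    intro i
    rw [← hfγ, ← show _ = P (σ i) from hmarg i]
    have := Measure.map_prod_map μ (volume : Measure unitInterval)
      (measurable_pi_apply (X := fun _ : ι => X) i) measurable_id
    rw [Measure.map_id] at this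
    have hfi := hf (σ i) (σ' i)
    rw [this, Measure.map_map (by fun_prop) (by fun_prop)]
    rfl
  have hmove : ∀ i, ∫⁻ z, edist (z.1 i) (F z i) ∂ν ≤
      ENNReal.ofReal (1 + ε) * wass (P (σ i)) (P (σ' i)) := by
    intro i
    refine le_trans (le_of_eq ?_) (hγcost _ _)
    have := hFi i
    rw [← hlaw i, lintegral_map (by fun_prop) (by fun_prop)]
  have hstart : ∀ i j, ∫⁻ z, edist (z.1 i) (z.1 j) ∂ν ≤ D i j := by
    intro i j
    refine le_trans (le_of_eq ?_) (hcost i j)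
    rw [hν, lintegral_prod _ (by fun_prop)]
    simp
  refine ⟨fun i j => ∫⁻ z, edist (F z i) (F z j) ∂ν, ⟨ν.map F,
    Measure.isProbabilityMeasure_map hFm.aemeasurable, fun i => ?_, fun i j => ?_⟩,
    fun i j hσ hσ' h0 => ?_, fun i j => ?_⟩
  · beta_reduce
    rw [Measure.map_map (by fun_prop) hFm, ← (hγ (σ i) (σ' i)).map_snd, ← hlaw i,
      Measure.map_map measurable_snd (by have := hFi i; fun_prop)]
    rfl
  · rw [lintegral_map (by fun_prop) hFm]
  · have hz : ∫⁻ z, edist (z.1 i) (z.1 j) ∂ν = 0 :=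
      le_antisymm ((hstart i j).trans h0.le) zero_le
    rw [lintegral_eq_zero_iff (by fun_prop)] at hz
    rw [lintegral_eq_zero_iff (by have := hFi i; have := hFi j; fun_prop)]
    filter_upwards [hz] with z hz
    simp only [Pi.zero_apply, edist_eq_zero] at hz ⊢
    simp only [hF, hσ, hσ', hz]
  · have hi := hFi i
    have hj := hFi j
    calc ∫⁻ z, edist (F z i) (F z j) ∂ν
        ≤ ∫⁻ z, (edist (z.1 i) (z.1 j) + (edist (z.1 i) (F z i) + edist (z.1 j) (F z j))) ∂ν := by
          refine lintegral_mono fun z => ?_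
          calc edist (F z i) (F z j)
              ≤ edist (F z i) (z.1 i) + edist (z.1 i) (z.1 j) + edist (z.1 j) (F z j) :=
                edist_triangle4 _ _ _ _
            _ = _ := by rw [edist_comm (F z i)]; ring
      _ = ∫⁻ z, edist (z.1 i) (z.1 j) ∂ν + (∫⁻ z, edist (z.1 i) (F z i) ∂ν +
            ∫⁻ z, edist (z.1 j) (F z j) ∂ν) := by
          rw [lintegral_add_left (by fun_prop), lintegral_add_left (by fun_prop)]
      _ ≤ _ := by
          rw [mul_add]
          exact add_le_add (hstart i j) (add_le_add (hmove i) (hmove j))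

/-- Coupling along a hierarchy of assignments `σ 0, …, σ k` of centres, where `σ l` moves points
by at most `r l` and the scales `r` decrease by factors of five. -/
theorem hasCoupling_hierarchy [Fintype A] [DecidableEq A] (P : A → Measure X)
    [∀ a, IsProbabilityMeasure (P a)] {ε : ℝ} (hε : 0 < ε) (σ : ℕ → A → A) (r : ℕ → ℝ≥0∞)
    (hr : ∀ l, r l = 5 * r (l + 1)) (hσ : ∀ l a, wass (P a) (P (σ l a)) ≤ r l) (k : ℕ) :
    ∃ D, HasCoupling (fun a => P (σ k a)) D ∧ ∀ a b, σ 0 a = σ 0 b →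
      ((∀ l ≤ k, σ l a = σ l b) ∧ D a b = 0) ∨
      D a b + ENNReal.ofReal (1 + ε) * (3 * r k) ≤ ENNReal.ofReal (1 + ε) *
        (15 * ∑ l ∈ Finset.range k, if σ (l + 1) a = σ (l + 1) b then 0 else r (l + 1)) := by
  induction k with
  | zero =>
    refine ⟨_, (hasCoupling_independent P).comap (σ 0), fun a b hab => Or.inl ⟨?_, by simp [hab]⟩⟩
    intro l hl
    rwa [Nat.le_zero.1 hl]
  | succ k ih =>
    obtain ⟨D, hD, hDb⟩ := ih
    obtain ⟨D', hD', hzero, hle⟩ := hD.move hε (σ' := σ (k + 1))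
    refine ⟨D', hD', fun a b hab => ?_⟩
    set K := ENNReal.ofReal (1 + ε)
    have hstep : ∀ a, wass (P (σ k a)) (P (σ (k + 1) a)) ≤ 6 * r (k + 1) := by
      intro a
      refine (wass_triangle _ (P a) _).trans ?_
      rw [wass_comm]
      refine (add_le_add (hσ k a) (hσ (k + 1) a)).trans (le_of_eq ?_)
      rw [hr k]
      ring
    have hle' : D' a b ≤ D a b + K * (12 * r (k + 1)) := by
      refine (hle a b).trans ?_
      gcongr
      refine (add_le_add (hstep a) (hstep b)).trans (le_of_eq ?_)
      ring
    rcases hDb a b hab with ⟨hag, h0⟩ | hb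
    · by_cases hk : σ (k + 1) a = σ (k + 1) b
      · left
        refine ⟨fun l hl => ?_, hzero a b (hag k le_rfl) hk h0⟩
        rcases Nat.le_succ_iff.1 hl with h | rfl
        · exact hag l h
        · exact hk
      · right
        rw [Finset.sum_range_succ, if_neg hk]
        calc D' a b + K * (3 * r (k + 1)) ≤ 0 + K * (12 * r (k + 1)) + K * (3 * r (k + 1)) := by
              rw [h0] at hle'
              gcongr
          _ = K * (15 * r (k + 1)) := by ring
          _ ≤ _ := by gcongr; exact le_add_self
    · right
      calc D' a b + K * (3 * r (k + 1)) ≤ D a b + K * (12 * r (k + 1)) + K * (3 * r (k + 1)) := by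
            gcongr
        _ = D a b + K * (3 * r k) := by rw [hr k]; ring
        _ ≤ _ := hb
        _ ≤ _ := by
          gcongr
          simp

end Couplings

section RandomCentres

variable {A : Type*} [Fintype A] [DecidableEq A]

/-- `c` is the element of smallest index in the ball of radius `r` around `a`. -/
def IsCentre (d : A → A → ℝ≥0∞) (r : ℝ≥0∞) (π : A ≃ Fin (Fintype.card A)) (a c : A) : Prop :=
  d a c ≤ r ∧ ∀ w, d a w ≤ r → π c ≤ π w

omit [DecidableEq A] in
theorem exists_isCentre {d : A → A → ℝ≥0∞} (hd : ∀ a, d a a = 0) (r : ℝ≥0∞)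
    (π : A ≃ Fin (Fintype.card A)) (a : A) : ∃ c, IsCentre d r π a c := by
  obtain ⟨c, hc, hmin⟩ := Finset.exists_min_image (Finset.univ.filter fun w => d a w ≤ r) π
    ⟨a, by simp [hd]⟩
  simp only [Finset.mem_filter, Finset.mem_univ, true_and] at hc hmin
  exact ⟨c, hc, hmin⟩

/-- The points at least as close to the pair `{a, b}` as `w`. -/
def closerSet (d : A → A → ℝ≥0∞) (a b w : A) : Finset A :=
  Finset.univ.filter fun w' => min (d a w') (d b w') ≤ min (d a w) (d b w)

omit [DecidableEq A] in
theorem mem_closerSet_self (d : A → A → ℝ≥0∞) (a b w : A) : w ∈ closerSet d a b w := by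
  simp [closerSet]

omit [DecidableEq A] in
theorem exists_cutting_centre {d : A → A → ℝ≥0∞} {r : ℝ≥0∞} {π : A ≃ Fin (Fintype.card A)}
    {a b c c' : A} (h : IsCentre d r π a c) (h' : IsCentre d r π b c') (hne : c ≠ c') :
    ∃ w, (min (d a w) (d b w) ≤ r ∧ r < max (d a w) (d b w)) ∧
      ∀ w' ∈ closerSet d a b w, π w ≤ π w' := by
  simp only [closerSet, Finset.mem_filter, Finset.mem_univ, true_and]
  rcases le_total (π c) (π c') with hle | hle
  · refine ⟨c, ⟨min_le_of_left_le h.1, lt_max_of_lt_right ?_⟩, fun w' hw' => ?_⟩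
    · by_contra! hb
      exact hne (π.injective (le_antisymm hle (h'.2 c hb)))
    · rcases min_le_iff.1 (hw'.trans (min_le_of_left_le h.1)) with h1 | h1
      · exact h.2 w' h1
      · exact hle.trans (h'.2 w' h1)
  · refine ⟨c', ⟨min_le_of_right_le h'.1, lt_max_of_lt_left ?_⟩, fun w' hw' => ?_⟩
    · by_contra! hb
      exact hne (π.injective (le_antisymm (h.2 c' hb) hle))
    · rcases min_le_iff.1 (hw'.trans (min_le_of_right_le h'.1)) with h1 | h1
      · exact hle.trans (h.2 w' h1)
      · exact h'.2 w' h1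

/-- In a uniformly random order, a given element of `S` comes first with probability `1 / |S|`. -/
theorem card_first_mul_card_le (S : Finset A) {w : A} (hw : w ∈ S) :
    (Finset.univ.filter fun π : A ≃ Fin (Fintype.card A) => ∀ w' ∈ S, π w ≤ π w').card * S.card ≤
      Fintype.card (A ≃ Fin (Fintype.card A)) := by
  set F : A → Finset (A ≃ Fin (Fintype.card A)) :=
    fun v => Finset.univ.filter fun π => ∀ w' ∈ S, π v ≤ π w' with hF
  have hcard : ∀ v ∈ S, (F w).card ≤ (F v).card := by
    intro v hv
    refine Finset.card_le_card_of_injOn (fun π => (Equiv.swap v w).trans π) ?_ ?_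
    · intro π hπ
      simp only [hF, Finset.coe_filter, Finset.mem_univ, true_and, Set.mem_ofPred_eq] at hπ ⊢
      intro w' hw'
      simp only [Equiv.trans_apply, Equiv.swap_apply_left]
      refine hπ _ ?_
      rw [Equiv.swap_apply_def]
      split_ifs
      · exact hw
      · exact hv
      · exact hw'
    · intro π _ π' _ h
      ext x
      have := congrArg (fun e : A ≃ Fin (Fintype.card A) => e (Equiv.swap v w x)) h
      simpa using congrArg Fin.val this
  have hdisj : Set.PairwiseDisjoint (S : Set A) F := by
    intro u hu v hv huv
    refine Finset.disjoint_left.2 fun π hπu hπv => huv ?_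
    simp only [hF, Finset.mem_filter, Finset.mem_univ, true_and] at hπu hπv
    exact π.injective (le_antisymm (hπu v hv) (hπv u hu))
  calc (F w).card * S.card = ∑ _v ∈ S, (F w).card := by
        rw [Finset.sum_const, smul_eq_mul, mul_comm]
    _ ≤ ∑ v ∈ S, (F v).card := Finset.sum_le_sum hcard
    _ = (S.biUnion F).card := (Finset.card_biUnion hdisj).symm
    _ ≤ _ := Finset.card_le_univ _

/-- A random order separates `a` and `b` at scale `r` with small probability. -/
theorem sum_separated_le (d : A → A → ℝ≥0∞) (r : ℝ≥0∞)
    (c : (A ≃ Fin (Fintype.card A)) → A → A) (hc : ∀ π a, IsCentre d r π a (c π a)) (a b : A) :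
    ∑ π, (if c π a = c π b then (0 : ℝ) else 1) ≤
      Fintype.card (A ≃ Fin (Fintype.card A)) *
        ∑ w, if min (d a w) (d b w) ≤ r ∧ r < max (d a w) (d b w) then
          (1 / (closerSet d a b w).card : ℝ) else 0 := by
  calc ∑ π, (if c π a = c π b then (0 : ℝ) else 1)
      ≤ ∑ π : A ≃ Fin (Fintype.card A), ∑ w,
          (if min (d a w) (d b w) ≤ r ∧ r < max (d a w) (d b w) then
            (if ∀ w' ∈ closerSet d a b w, π w ≤ π w' then (1 : ℝ) else 0) else 0) := by
        refine Finset.sum_le_sum fun π _ => ?_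
        have hnn : ∀ w ∈ (Finset.univ : Finset A), (0 : ℝ) ≤
            (if min (d a w) (d b w) ≤ r ∧ r < max (d a w) (d b w) then
              (if ∀ w' ∈ closerSet d a b w, π w ≤ π w' then (1 : ℝ) else 0) else 0) := by
          intro w _
          positivity
        split_ifs with h
        · exact Finset.sum_nonneg hnn
        · obtain ⟨w, hw, hmin⟩ := exists_cutting_centre (hc π a) (hc π b) h
          refine le_trans ?_ (Finset.single_le_sum hnn (Finset.mem_univ w))
          rw [if_pos hw, if_pos hmin]
    _ = ∑ w, (if min (d a w) (d b w) ≤ r ∧ r < max (d a w) (d b w) then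
          ((Finset.univ.filter fun π : A ≃ Fin (Fintype.card A) =>
            ∀ w' ∈ closerSet d a b w, π w ≤ π w').card : ℝ) else 0) := by
        rw [Finset.sum_comm]
        refine Finset.sum_congr rfl fun w _ => ?_
        split_ifs with h
        · rw [Finset.sum_boole]
        · simp
    _ ≤ _ := by
        rw [Finset.mul_sum]
        refine Finset.sum_le_sum fun w _ => ?_
        split_ifs with h
        · have hpos : (0 : ℝ) < (closerSet d a b w).card := by
            exact_mod_cast Finset.card_pos.2 ⟨w, mem_closerSet_self d a b w⟩
          rw [mul_one_div, le_div_iff₀ hpos]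
          exact_mod_cast card_first_mul_card_le _ (mem_closerSet_self d a b w)
        · simp

omit [Fintype A] in
theorem sum_inv_card_le_harmonic {β : Type*} [LinearOrder β] (m : A → β) (T : Finset A) :
    ∑ w ∈ T, (1 / (T.filter fun w' => m w' ≤ m w).card : ℝ) ≤ (harmonic T.card : ℝ) := by
  induction T using Finset.induction_on_max_value m with
  | empty => simp
  | insert a s ha hmax ih =>
    rw [Finset.sum_insert ha, Finset.card_insert_of_notMem ha, harmonic_succ, add_comm]
    push_cast
    refine add_le_add ((Finset.sum_le_sum fun w hw => ?_).trans ih) (le_of_eq ?_)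
    · have hpos : 0 < (s.filter fun w' => m w' ≤ m w).card :=
        Finset.card_pos.2 ⟨w, by simp [hw]⟩
      have hle : (s.filter fun w' => m w' ≤ m w).card ≤
          ((insert a s).filter fun w' => m w' ≤ m w).card :=
        Finset.card_le_card (Finset.filter_subset_filter _ (Finset.subset_insert a s))
      exact one_div_le_one_div_of_le (by exact_mod_cast hpos) (by exact_mod_cast hle)
    · rw [Finset.filter_true_of_mem, Finset.card_insert_of_notMem ha]
      · simp
      · intro w hw
        rcases Finset.mem_insert.1 hw with rfl | hw
        · exact le_rfl
        · exact hmax w hw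

end RandomCentres

section Scales

/-- The function `s ↦ exp (L s)` restricted to the region where its value lies in `[a, b)`. -/
def scaleWindow (L a b s : ℝ) : ℝ :=
  if a ≤ Real.exp (L * s) ∧ Real.exp (L * s) < b then Real.exp (L * s) else 0

theorem scaleWindow_nonneg (L a b s : ℝ) : 0 ≤ scaleWindow L a b s := by
  unfold scaleWindow
  positivity

theorem measurableSet_scaleWindow (L a b : ℝ) :
    MeasurableSet {s : ℝ | a ≤ Real.exp (L * s) ∧ Real.exp (L * s) < b} := by
  have h1 : MeasurableSet {s : ℝ | a ≤ Real.exp (L * s)} :=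
    measurableSet_le (by fun_prop) (by fun_prop)
  have h2 : MeasurableSet {s : ℝ | Real.exp (L * s) < b} :=
    measurableSet_lt (by fun_prop) (by fun_prop)
  exact h1.inter h2

theorem scaleWindow_eq_indicator (L a b : ℝ) :
    scaleWindow L a b = Set.indicator {s : ℝ | a ≤ Real.exp (L * s) ∧ Real.exp (L * s) < b}
      fun s => Real.exp (L * s) := by
  ext s
  simp [scaleWindow, Set.indicator_apply]

theorem intervalIntegrable_scaleWindow (L a b u v : ℝ) :
    IntervalIntegrable (scaleWindow L a b) volume u v := by
  have hc : Continuous fun s : ℝ => Real.exp (L * s) := by fun_prop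
  rw [scaleWindow_eq_indicator, intervalIntegrable_iff]
  exact (intervalIntegrable_iff.1 (hc.intervalIntegrable u v)).indicator
    (measurableSet_scaleWindow L a b)

theorem integral_scaleWindow_le {L a b u v : ℝ} (hL : 0 < L) (ha : 0 ≤ a) (hab : a ≤ b)
    (huv : u ≤ v) : ∫ s in u..v, scaleWindow L a b s ≤ (b - a) / L := by
  have hnn : 0 ≤ (b - a) / L := div_nonneg (sub_nonneg.2 hab) hL.le
  obtain ⟨A, hA, hAa⟩ : ∃ A, (∀ s, u < s → a ≤ Real.exp (L * s) → A ≤ s) ∧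
      a ≤ Real.exp (L * A) := by
    rcases ha.eq_or_lt with rfl | ha
    · exact ⟨u, fun s hs _ => hs.le, (Real.exp_pos _).le⟩
    · refine ⟨Real.log a / L, fun s _ hs => ?_, ?_⟩
      · rw [div_le_iff₀' hL]
        exact (Real.log_le_iff_le_exp ha).2 hs
      · rw [mul_div_cancel₀ _ hL.ne', Real.exp_log ha]
  rcases (ha.trans hab).eq_or_lt with rfl | hb
  · have : scaleWindow L a 0 = 0 := by
      ext s
      simp [scaleWindow, (Real.exp_pos (L * s)).not_gt]
    rw [this]
    simpa using hnn
  set B := Real.log b / L with hBdef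
  have hBb : Real.exp (L * B) = b := by rw [mul_div_cancel₀ _ hL.ne', Real.exp_log hb]
  have hB : ∀ s, Real.exp (L * s) < b → s ≤ B := by
    intro s hs
    rw [hBdef, le_div_iff₀' hL]
    exact (Real.le_log_iff_exp_le hb).2 hs.le
  rw [intervalIntegral.integral_of_le huv, scaleWindow_eq_indicator,
    setIntegral_indicator (measurableSet_scaleWindow L a b)]
  have hsub : Set.Ioc u v ∩ {s : ℝ | a ≤ Real.exp (L * s) ∧ Real.exp (L * s) < b} ⊆
      Set.Icc A B := fun s hs => ⟨hA s hs.1.1 hs.2.1, hB s hs.2.2⟩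
  have hc : Continuous fun s : ℝ => Real.exp (L * s) := by fun_prop
  rcases le_or_gt A B with hAB | hAB
  · calc _ ≤ ∫ s in Set.Icc A B, Real.exp (L * s) := by
          refine setIntegral_mono_set hc.continuousOn.integrableOn_Icc
            (Filter.Eventually.of_forall fun s => (Real.exp_pos _).le) hsub.eventuallyLE
      _ = ∫ s in A..B, Real.exp (L * s) := by
          rw [integral_Icc_eq_integral_Ioc, intervalIntegral.integral_of_le hAB]
      _ = Real.exp (L * B) / L - Real.exp (L * A) / L := by
          refine intervalIntegral.integral_eq_sub_of_hasDerivAt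
            (f := fun s => Real.exp (L * s) / L) (fun s _ => ?_) (hc.intervalIntegrable _ _)
          have := (((hasDerivAt_id s).const_mul L).exp).div_const L
          simpa [hL.ne'] using this
      _ ≤ (b - a) / L := by
          rw [hBb, ← sub_div]
          gcongr
  · rw [Set.Icc_eq_empty hAB.not_ge, Set.subset_empty_iff] at hsub
    rw [hsub]
    simpa using hnn

theorem intervalIntegrable_scaleWindow_shift (L a b c u v : ℝ) :
    IntervalIntegrable (fun t => scaleWindow L a b (t + c)) volume u v := by
  simpa using (intervalIntegrable_scaleWindow L a b (u + c) (v + c)).comp_add_right c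

theorem intervalIntegrable_sum_scaleWindow (L a b c u v : ℝ) (k : ℕ) :
    IntervalIntegrable (fun t => ∑ l ∈ Finset.range k, scaleWindow L a b (t + (c - (l + 1))))
      volume u v := by
  have := IntervalIntegrable.sum (Finset.range k) fun (l : ℕ) _ =>
    intervalIntegrable_scaleWindow_shift L a b (c - (l + 1)) u v
  simpa only [Finset.sum_fn] using this

theorem integral_sum_scaleWindow_le {L a b : ℝ} (hL : 0 < L) (ha : 0 ≤ a) (hab : a ≤ b)
    (c : ℝ) (k : ℕ) :
    ∫ t in (0 : ℝ)..1, ∑ l ∈ Finset.range k, scaleWindow L a b (t + (c - (l + 1))) ≤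
      (b - a) / L := by
  rw [intervalIntegral.integral_finsetSum fun l _ =>
    intervalIntegrable_scaleWindow_shift L a b _ 0 1]
  rw [← Finset.sum_range_reflect]
  have hterm : ∀ j ∈ Finset.range k,
      ∫ t in (0 : ℝ)..1, scaleWindow L a b (t + (c - ((k - 1 - j : ℕ) + 1))) =
        ∫ t in (c - k + (j : ℕ))..(c - k + (j + 1 : ℕ)), scaleWindow L a b t := by
    intro j hj
    have hjk : j + 1 ≤ k := Finset.mem_range.1 hj
    rw [intervalIntegral.integral_comp_add_right, show k - 1 - j = k - (j + 1) by omega]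
    push_cast [Nat.cast_sub hjk]
    congr 1 <;> ring
  rw [Finset.sum_congr rfl hterm, intervalIntegral.sum_integral_adjacent_intervals
    (a := fun j : ℕ => c - k + j) fun j _ => intervalIntegrable_scaleWindow L a b _ _]
  refine integral_scaleWindow_le hL ha hab ?_
  simp

end Scales

section Assembly

variable {X A : Type*} [MetricSpace X] [MeasurableSpace X]

/-- Bounds on the pairwise expected distances which are attained by some coupling of `P`. -/
def feasible (P : A → Measure X) : Set (A × A → ℝ) :=
  {z | (∀ p, 0 ≤ z p) ∧ ∃ D, HasCoupling P D ∧
    ∀ a b, wass (P a) (P b) ≠ ∞ → D a b ≤ ENNReal.ofReal (z (a, b))}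

theorem feasible_mono {P : A → Measure X} {z z' : A × A → ℝ} (hz : z ∈ feasible P)
    (h0 : ∀ p, 0 ≤ z' p) (h : ∀ a b, wass (P a) (P b) ≠ ∞ → z (a, b) ≤ z' (a, b)) :
    z' ∈ feasible P := by
  obtain ⟨-, D, hD, hle⟩ := hz
  exact ⟨h0, D, hD, fun a b hab => (hle a b hab).trans (ENNReal.ofReal_le_ofReal (h a b hab))⟩

theorem convex_feasible (P : A → Measure X) : Convex ℝ (feasible P) := by
  rintro z ⟨hz0, D, hD, hDz⟩ z' ⟨hz0', D', hD', hDz'⟩ s t hs ht hst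
  refine ⟨fun p => ?_, _, hD.convex_comb hD' (a := ENNReal.ofReal s) (b := ENNReal.ofReal t) ?_,
    fun a b hab => ?_⟩
  · have := hz0 p
    have := hz0' p
    simp only [Pi.add_apply, Pi.smul_apply, smul_eq_mul]
    positivity
  · rw [← ENNReal.ofReal_add hs ht, hst, ENNReal.ofReal_one]
  · simp only [Pi.add_apply, Pi.smul_apply, smul_eq_mul]
    rw [ENNReal.ofReal_add (mul_nonneg hs (hz0 _)) (mul_nonneg ht (hz0' _)),
      ENNReal.ofReal_mul hs, ENNReal.ofReal_mul ht]
    gcongr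
    · exact hDz a b hab
    · exact hDz' a b hab

theorem ite_window_eq {L s : ℝ} {x y : ℝ≥0∞} (h : x = ∞ ↔ y = ∞) :
    (if x ≤ ENNReal.ofReal (Real.exp (L * s)) ∧ ENNReal.ofReal (Real.exp (L * s)) < y then
      Real.exp (L * s) else 0) = scaleWindow L x.toReal y.toReal s := by
  have hpos := Real.exp_pos (L * s)
  unfold scaleWindow
  by_cases hx : x = ∞
  · simp [hx, h.1 hx, hpos.not_gt]
  · have hy : y ≠ ∞ := fun hy => hx (h.2 hy)
    have h1 : x ≤ ENNReal.ofReal (Real.exp (L * s)) ↔ x.toReal ≤ Real.exp (L * s) := by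
      rw [← ENNReal.ofReal_le_ofReal_iff hpos.le, ENNReal.ofReal_toReal hx]
    simp only [h1, ENNReal.ofReal_lt_iff_lt_toReal hpos.le hy]

variable [SecondCountableTopology X] [BorelSpace X] [CompleteSpace X] [Fintype A] [DecidableEq A]

theorem hierarchy_mem_feasible (P : A → Measure X) [∀ a, IsProbabilityMeasure (P a)]
    {ε : ℝ} (hε : 0 < ε) (r : ℕ → ℝ) (hr0 : ∀ l, 0 < r l) (hr : ∀ l, r l = 5 * r (l + 1)) (k : ℕ)
    (htop : ∀ a b, wass (P a) (P b) ≠ ∞ → wass (P a) (P b) ≤ ENNReal.ofReal (r 0))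
    (hbot : ∀ a b, a ≠ b → ENNReal.ofReal (r k) < wass (P a) (P b))
    (π : A ≃ Fin (Fintype.card A)) (c : ℕ → A → A)
    (hc : ∀ l a, IsCentre (fun a b => wass (P a) (P b)) (ENNReal.ofReal (r l)) π a (c l a)) :
    (fun p : A × A => (1 + ε) * (15 * ∑ l ∈ Finset.range k,
      if c (l + 1) p.1 = c (l + 1) p.2 then 0 else r (l + 1))) ∈ feasible P := by
  have hnn : ∀ a b, ∀ l ∈ Finset.range k,
      0 ≤ if c (l + 1) a = c (l + 1) b then 0 else r (l + 1) := by
    intro a b l _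
    have := (hr0 (l + 1)).le
    positivity
  have hck : ∀ a, c k a = a := by
    intro a
    by_contra hne
    exact ((hc k a).1.trans_lt (hbot a _ (Ne.symm hne))).false
  have hc0 : ∀ a b, wass (P a) (P b) ≠ ∞ → c 0 a = c 0 b := by
    have key : ∀ a b, wass (P a) (P b) ≠ ∞ → π (c 0 a) ≤ π (c 0 b) := by
      intro a b hab
      refine (hc 0 a).2 _ (htop _ _ ?_)
      have hb : wass (P b) (P (c 0 b)) ≠ ∞ := ((hc 0 b).1.trans_lt ENNReal.ofReal_lt_top).ne
      exact ((wass_triangle _ _ _).trans_lt (ENNReal.add_lt_top.2 ⟨hab.lt_top, hb.lt_top⟩)).ne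
    intro a b hab
    exact π.injective (le_antisymm (key a b hab) (key b a (by rwa [wass_comm])))
  obtain ⟨D, hD, hDb⟩ := hasCoupling_hierarchy P hε c (fun l => ENNReal.ofReal (r l))
    (fun l => by rw [hr l, ENNReal.ofReal_mul (by norm_num)]; norm_num) (fun l a => (hc l a).1) k
  simp only [hck] at hD
  refine ⟨fun p => ?_, D, hD, fun a b hab => ?_⟩
  · have := Finset.sum_nonneg (hnn p.1 p.2)
    positivity
  · rcases hDb a b (hc0 a b hab) with ⟨-, h0⟩ | h
    · rw [h0]
      exact zero_le
    · refine le_self_add.trans (h.trans (le_of_eq ?_))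
      rw [ENNReal.ofReal_mul (by positivity), ENNReal.ofReal_mul (by norm_num),
        ENNReal.ofReal_sum_of_nonneg (hnn a b)]
      congr 2
      · norm_num
      · refine Finset.sum_congr rfl fun l _ => ?_
        split_ifs <;> simp

/-- The bound on pairwise costs obtained by averaging over all orders at the scale offset `t`. -/
def averagedBound (P : A → Measure X) (ε c : ℝ) (k : ℕ) (t : ℝ) (p : A × A) : ℝ :=
  if wass (P p.1) (P p.2) = ∞ then 0 else
    (1 + ε) * (15 * ∑ w, (1 / (closerSet (fun a b => wass (P a) (P b)) p.1 p.2 w).card : ℝ) *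
      ∑ l ∈ Finset.range k, scaleWindow (Real.log 5)
        (min (wass (P p.1) (P w)) (wass (P p.2) (P w))).toReal
        (max (wass (P p.1) (P w)) (wass (P p.2) (P w))).toReal (t + (c - (l + 1))))

theorem min_eq_top_iff_max_eq_top {P Q R : Measure X} (h : wass P Q ≠ ∞) :
    min (wass P R) (wass Q R) = ∞ ↔ max (wass P R) (wass Q R) = ∞ := by
  have h1 := wass_triangle P Q R
  have h2 := wass_triangle Q P R
  rw [wass_comm Q P] at h2
  simp only [min_eq_top, max_eq_top]
  refine ⟨fun h => Or.inl h.1, ?_⟩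
  rintro (h' | h')
  · rw [h', top_le_iff, ENNReal.add_eq_top] at h1
    exact ⟨h', h1.resolve_left h⟩
  · rw [h', top_le_iff, ENNReal.add_eq_top] at h2
    exact ⟨h2.resolve_left h, h'⟩

theorem max_toReal_sub_min_toReal_le {P Q R : Measure X} (h : wass P Q ≠ ∞) :
    (max (wass P R) (wass Q R)).toReal - (min (wass P R) (wass Q R)).toReal ≤
      (wass P Q).toReal := by
  by_cases hm : min (wass P R) (wass Q R) = ∞
  · rw [(min_eq_top_iff_max_eq_top h).1 hm, hm]
    simp
  · have hm' := mt (min_eq_top_iff_max_eq_top h).2 hm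
    rw [sub_le_iff_le_add, ← ENNReal.toReal_add h hm]
    refine ENNReal.toReal_mono (ENNReal.add_ne_top.2 ⟨h, hm⟩) ?_
    have h1 := wass_triangle P Q R
    have h2 := wass_triangle Q P R
    rw [wass_comm Q P] at h2
    rcases le_total (wass P R) (wass Q R) with hle | hle
    · rwa [max_eq_right hle, min_eq_left hle]
    · rwa [max_eq_left hle, min_eq_right hle]

theorem averagedBound_mem_feasible (P : A → Measure X) [∀ a, IsProbabilityMeasure (P a)]
    {ε : ℝ} (hε : 0 < ε) {c t : ℝ} {k : ℕ}
    (htop : ∀ a b, wass (P a) (P b) ≠ ∞ →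
      wass (P a) (P b) ≤ ENNReal.ofReal (Real.exp (Real.log 5 * (t + c))))
    (hbot : ∀ a b, a ≠ b →
      ENNReal.ofReal (Real.exp (Real.log 5 * (t + (c - k)))) < wass (P a) (P b)) :
    averagedBound P ε c k t ∈ feasible P := by
  set d : A → A → ℝ≥0∞ := fun a b => wass (P a) (P b) with hd
  set r : ℕ → ℝ := fun l => Real.exp (Real.log 5 * (t + (c - l))) with hr
  have hr0 : ∀ l, 0 < r l := fun l => Real.exp_pos _
  choose σ hσ using fun (π : A ≃ Fin (Fintype.card A)) (l : ℕ) (a : A) =>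
    exists_isCentre (d := d) (fun a => wass_self (P a)) (ENNReal.ofReal (r l)) π a
  have hmem : ∀ π, (fun p : A × A => (1 + ε) * (15 * ∑ l ∈ Finset.range k,
      if σ π (l + 1) p.1 = σ π (l + 1) p.2 then 0 else r (l + 1))) ∈ feasible P := by
    intro π
    refine hierarchy_mem_feasible P hε r hr0 (fun l => ?_) k ?_ hbot π (σ π) (hσ π)
    · simp only [hr]
      rw [← Real.exp_log (show (0 : ℝ) < 5 by norm_num), ← Real.exp_add, Real.log_exp]
      congr 1
      push_cast
      ring
    · simpa [hr] using htop
  set N : ℝ := (Fintype.card (A ≃ Fin (Fintype.card A)) : ℝ) with hN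
  have hNpos : 0 < N := by
    have : Nonempty (A ≃ Fin (Fintype.card A)) := ⟨Fintype.equivFin A⟩
    exact Nat.cast_pos.2 Fintype.card_pos
  have havg := (convex_feasible P).sum_mem (t := (Finset.univ : Finset (A ≃ Fin (Fintype.card A))))
    (w := fun _ => N⁻¹) (fun _ _ => by positivity)
    (by rw [Finset.sum_const, Finset.card_univ, nsmul_eq_mul, ← hN, mul_inv_cancel₀ hNpos.ne'])
    fun π _ => hmem π
  refine feasible_mono havg (fun p => ?_) fun a b hab => ?_
  · unfold averagedBound
    split_ifs
    · exact le_rfl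
    · refine mul_nonneg (by positivity) (mul_nonneg (by norm_num) (Finset.sum_nonneg fun w _ => ?_))
      exact mul_nonneg (by positivity) (Finset.sum_nonneg fun l _ => scaleWindow_nonneg _ _ _ _)
  · rw [averagedBound, if_neg hab]
    simp only [Finset.sum_apply, Pi.smul_apply, smul_eq_mul]
    have hsep : ∀ l, N⁻¹ * ∑ π, (if σ π (l + 1) a = σ π (l + 1) b then 0 else r (l + 1)) ≤
        ∑ w, (1 / (closerSet d a b w).card : ℝ) * scaleWindow (Real.log 5)
          (min (d a w) (d b w)).toReal (max (d a w) (d b w)).toReal (t + (c - (l + 1))) := by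
      intro l
      have h1 := sum_separated_le d (ENNReal.ofReal (r (l + 1))) (fun π => σ π (l + 1))
        (fun π a => hσ π (l + 1) a) a b
      rw [← hN, ← inv_mul_le_iff₀ hNpos] at h1
      have h2 := mul_le_mul_of_nonneg_left h1 (hr0 (l + 1)).le
      refine (le_of_eq ?_).trans (h2.trans (le_of_eq ?_))
      · rw [mul_left_comm, Finset.mul_sum (a := r (l + 1))]
        congr 1
        refine Finset.sum_congr rfl fun π _ => ?_
        split_ifs <;> simp
      · rw [Finset.mul_sum]
        refine Finset.sum_congr rfl fun w _ => ?_
        rw [← ite_window_eq (min_eq_top_iff_max_eq_top hab)]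
        simp only [hr]
        push_cast
        split_ifs
        · ring
        · simp
    calc ∑ π, N⁻¹ * ((1 + ε) * (15 * ∑ l ∈ Finset.range k,
          if σ π (l + 1) a = σ π (l + 1) b then 0 else r (l + 1)))
        = (1 + ε) * (15 * ∑ l ∈ Finset.range k,
            N⁻¹ * ∑ π, if σ π (l + 1) a = σ π (l + 1) b then 0 else r (l + 1)) := by
          rw [← Finset.mul_sum, ← Finset.mul_sum, ← Finset.mul_sum, Finset.sum_comm,
            ← Finset.mul_sum]
          ring
      _ ≤ (1 + ε) * (15 * ∑ l ∈ Finset.range k, ∑ w, (1 / (closerSet d a b w).card : ℝ) *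
            scaleWindow (Real.log 5) (min (d a w) (d b w)).toReal (max (d a w) (d b w)).toReal
              (t + (c - (l + 1)))) := by
          gcongr with l _
          exact hsep l
      _ = _ := by
          rw [Finset.sum_comm]
          simp only [Finset.mul_sum, hd]

omit [SecondCountableTopology X] [BorelSpace X] [CompleteSpace X] [DecidableEq A] in
theorem intervalIntegrable_averagedBound (P : A → Measure X) (ε c : ℝ) (k : ℕ) (p : A × A) :
    IntervalIntegrable (fun t => averagedBound P ε c k t p) volume 0 1 := by
  unfold averagedBound
  split_ifs
  · simp
  · have hsum := IntervalIntegrable.sum (μ := volume) (a := 0) (b := 1) Finset.univ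
      (f := fun (w : A) (t : ℝ) =>
        (1 / (closerSet (fun a b => wass (P a) (P b)) p.1 p.2 w).card : ℝ) *
          ∑ l ∈ Finset.range k, scaleWindow (Real.log 5)
            (min (wass (P p.1) (P w)) (wass (P p.2) (P w))).toReal
            (max (wass (P p.1) (P w)) (wass (P p.2) (P w))).toReal (t + (c - (l + 1))))
      fun w _ => (intervalIntegrable_sum_scaleWindow _ _ _ _ _ _ _).const_mul _
    simp only [Finset.sum_fn] at hsum
    exact (hsum.const_mul 15).const_mul (1 + ε)

theorem integral_averagedBound_le (P : A → Measure X) {ε : ℝ} (hε : 0 < ε) (c : ℝ) (k : ℕ)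
    {a b : A} (hab : wass (P a) (P b) ≠ ∞) :
    ∫ t in (0 : ℝ)..1, averagedBound P ε c k t (a, b) ≤
      (1 + ε) * (15 * (harmonic (Fintype.card A) * ((wass (P a) (P b)).toReal / Real.log 5))) := by
  have hL : 0 < Real.log 5 := Real.log_pos (by norm_num)
  simp only [averagedBound, if_neg hab]
  rw [intervalIntegral.integral_const_mul, intervalIntegral.integral_const_mul,
    intervalIntegral.integral_finsetSum fun w _ =>
      (intervalIntegrable_sum_scaleWindow _ _ _ _ _ _ _).const_mul _]
  have hharm := sum_inv_card_le_harmonic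
    (fun w => min (wass (P a) (P w)) (wass (P b) (P w))) (Finset.univ : Finset A)
  rw [Finset.card_univ] at hharm
  gcongr
  calc _ ≤ ∑ w, (1 / (closerSet (fun a b => wass (P a) (P b)) a b w).card : ℝ) *
          ((wass (P a) (P b)).toReal / Real.log 5) := by
        refine Finset.sum_le_sum fun w _ => ?_
        rw [intervalIntegral.integral_const_mul]
        have hle : (min (wass (P a) (P w)) (wass (P b) (P w))).toReal ≤
            (max (wass (P a) (P w)) (wass (P b) (P w))).toReal := by
          by_cases hm : max (wass (P a) (P w)) (wass (P b) (P w)) = ∞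
          · rw [(min_eq_top_iff_max_eq_top hab).2 hm, hm]
          · exact ENNReal.toReal_mono hm min_le_max
        gcongr
        refine (integral_sum_scaleWindow_le hL ENNReal.toReal_nonneg hle c k).trans ?_
        gcongr
        exact max_toReal_sub_min_toReal_le hab
    _ ≤ _ := by
        rw [← Finset.sum_mul]
        refine mul_le_mul_of_nonneg_right hharm (by positivity)

end Assembly

section Main

variable {X A : Type*} [MetricSpace X] [MeasurableSpace X] [SecondCountableTopology X]
  [BorelSpace X] [CompleteSpace X] [Fintype A]

theorem exists_scale_range (d : A → A → ℝ≥0∞) (hd : ∀ a b, a ≠ b → d a b ≠ 0) :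
    ∃ m : ℕ, (∀ a b, d a b ≠ ∞ → d a b ≤ ENNReal.ofReal (Real.exp (Real.log 5 * m))) ∧
      ∀ a b, a ≠ b → ENNReal.ofReal (Real.exp (Real.log 5 * (1 - m))) < d a b := by
  have hL : 0 < Real.log 5 := Real.log_pos (by norm_num)
  have hup : Filter.Tendsto (fun m : ℕ => Real.log 5 * (m : ℝ)) Filter.atTop Filter.atTop :=
    tendsto_natCast_atTop_atTop.const_mul_atTop hL
  have hdown : Filter.Tendsto (fun m : ℕ => ENNReal.ofReal (Real.exp (Real.log 5 * (1 - m))))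
      Filter.atTop (nhds 0) := by
    rw [← ENNReal.ofReal_zero]
    refine ENNReal.tendsto_ofReal (Real.tendsto_exp_atBot.comp ?_)
    have := Filter.tendsto_neg_atTop_atBot.comp hup
    refine (Filter.tendsto_atBot_add_const_left _ (Real.log 5) this).congr fun m => ?_
    simp only [Function.comp]
    ring
  have h1 : ∀ᶠ m : ℕ in Filter.atTop, ∀ a b, d a b ≠ ∞ →
      d a b ≤ ENNReal.ofReal (Real.exp (Real.log 5 * m)) := by
    refine Filter.eventually_all.2 fun a => Filter.eventually_all.2 fun b => ?_
    filter_upwards [(Real.tendsto_exp_atTop.comp hup).eventually_ge_atTop (d a b).toReal]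
      with m hm hab
    rw [← ENNReal.ofReal_toReal hab]
    exact ENNReal.ofReal_le_ofReal hm
  have h2 : ∀ᶠ m : ℕ in Filter.atTop, ∀ a b, a ≠ b →
      ENNReal.ofReal (Real.exp (Real.log 5 * (1 - m))) < d a b := by
    refine Filter.eventually_all.2 fun a => Filter.eventually_all.2 fun b => ?_
    by_cases hab : a = b
    · exact Filter.Eventually.of_forall fun m h => absurd hab h
    · filter_upwards [hdown.eventually_lt_const (pos_iff_ne_zero.2 (hd a b hab))] with m hm _
      exact hm
  exact (h1.and h2).exists

theorem exists_hasCoupling_of_injective [DecidableEq A] (P : A → Measure X)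
    [∀ a, IsProbabilityMeasure (P a)] (hP : Injective P) {ε : ℝ} (hε : 0 < ε) :
    HasCoupling P fun a b => ENNReal.ofReal ((1 + ε) * (15 * (harmonic (Fintype.card A) /
      Real.log 5)) + ε) * wass (P a) (P b) := by
  have hL : 0 < Real.log 5 := Real.log_pos (by norm_num)
  have hharm : (0 : ℝ) ≤ harmonic (Fintype.card A) := by
    have : 0 ≤ harmonic (Fintype.card A) := Finset.sum_nonneg fun i _ => by positivity
    exact_mod_cast this
  have hne : ∀ a b, a ≠ b → wass (P a) (P b) ≠ 0 :=
    fun a b hab h => hab (hP (eq_of_wass_eq_zero h))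
  obtain ⟨m, htop, hbot⟩ := exists_scale_range (fun a b => wass (P a) (P b)) hne
  set Z := fun t => averagedBound P ε m (2 * m) t with hZ
  have hmem : ∀ t ∈ Set.Ioc (0 : ℝ) 1, Z t ∈ feasible P := by
    intro t ht
    refine averagedBound_mem_feasible P hε (fun a b hab => ?_) fun a b hab => ?_
    · refine (htop a b hab).trans (ENNReal.ofReal_le_ofReal (Real.exp_le_exp.2 ?_))
      have := ht.1
      gcongr
      linarith
    · refine (ENNReal.ofReal_le_ofReal (Real.exp_le_exp.2 ?_)).trans_lt (hbot a b hab)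
      have := ht.2
      gcongr
      push_cast
      linarith
  have hint : Integrable Z (volume.restrict (Set.Ioc (0 : ℝ) 1)) := by
    refine Integrable.of_eval fun p => ?_
    have := intervalIntegrable_averagedBound P ε m (2 * m) p
    rwa [intervalIntegrable_iff_integrableOn_Ioc_of_le zero_le_one] at this
  have : IsProbabilityMeasure (volume.restrict (Set.Ioc (0 : ℝ) 1)) := ⟨by simp⟩
  have hcl : ∫ t in Set.Ioc (0 : ℝ) 1, Z t ∈ closure (feasible P) := by
    refine (convex_feasible P).closure.integral_mem isClosed_closure ?_ hint
    filter_upwards [ae_restrict_mem measurableSet_Ioc] with t ht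
    exact subset_closure (hmem t ht)
  obtain ⟨δ, hδpos, hδ⟩ : ∃ δ : ℝ, 0 < δ ∧ ∀ a b, a ≠ b → wass (P a) (P b) ≠ ∞ →
      δ < ε * (wass (P a) (P b)).toReal := by
    have : ∀ᶠ δ in nhdsWithin (0 : ℝ) (Set.Ioi 0), ∀ a b, a ≠ b → wass (P a) (P b) ≠ ∞ →
        δ < ε * (wass (P a) (P b)).toReal := by
      refine Filter.eventually_all.2 fun a => Filter.eventually_all.2 fun b => ?_
      by_cases h : a ≠ b ∧ wass (P a) (P b) ≠ ∞
      · have hpos : 0 < ε * (wass (P a) (P b)).toReal :=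
          mul_pos hε (ENNReal.toReal_pos (hne a b h.1) h.2)
        filter_upwards [nhdsWithin_le_nhds (eventually_lt_nhds hpos)] with δ hδ _ _
        exact hδ
      · exact Filter.Eventually.of_forall fun δ h1 h2 => absurd ⟨h1, h2⟩ h
    obtain ⟨δ, h1, h2⟩ := (this.and self_mem_nhdsWithin).exists
    exact ⟨δ, h2, h1⟩
  obtain ⟨z, ⟨hz0, D, ⟨μ, hμ, hmarg, hcost⟩, hD⟩, hzδ⟩ := Metric.mem_closure_iff.1 hcl δ hδpos
  refine ⟨μ, hμ, hmarg, fun a b => ?_⟩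
  beta_reduce
  rcases eq_or_ne a b with rfl | hab
  · simp
  have hcoef : 0 < (1 + ε) * (15 * (harmonic (Fintype.card A) / Real.log 5)) + ε := by positivity
  rcases eq_or_ne (wass (P a) (P b)) ∞ with htp | htp
  · rw [htp, ENNReal.mul_top (by simpa using hcoef)]
    exact le_top
  refine (hcost a b).trans ((hD a b htp).trans ?_)
  conv_rhs => rw [← ENNReal.ofReal_toReal htp, ← ENNReal.ofReal_mul hcoef.le]
  refine ENNReal.ofReal_le_ofReal ?_
  have h1 : z (a, b) ≤ (∫ t in Set.Ioc (0 : ℝ) 1, Z t) (a, b) + δ := by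
    have := (dist_le_pi_dist _ z (a, b)).trans hzδ.le
    rw [Real.dist_eq] at this
    linarith [(abs_le.1 this).1]
  have h2 : (∫ t in Set.Ioc (0 : ℝ) 1, Z t) (a, b) = ∫ t in (0 : ℝ)..1, Z t (a, b) := by
    rw [intervalIntegral.integral_of_le zero_le_one]
    exact eval_integral (fun p => hint.eval p) (a, b)
  have h3 := integral_averagedBound_le P hε m (2 * m) htp
  have h4 := hδ a b hab htp
  calc z (a, b) ≤ _ := h1
    _ ≤ (1 + ε) * (15 * (harmonic (Fintype.card A) * ((wass (P a) (P b)).toReal / Real.log 5)))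
        + ε * (wass (P a) (P b)).toReal := by
      rw [h2]
      exact add_le_add h3 h4.le
    _ = _ := by ring

theorem exists_hasCoupling (P : A → Measure X) [∀ a, IsProbabilityMeasure (P a)] {R : ℝ}
    (hR : 15 * ((1 + Real.log (Fintype.card A)) / Real.log 5) < R) :
    HasCoupling P fun a b => ENNReal.ofReal R * wass (P a) (P b) := by
  classical
  have hL : 0 < Real.log 5 := Real.log_pos (by norm_num)
  have : Fintype (Set.range P) := Fintype.ofFinite _
  set h : ℝ := 15 * ((harmonic (Fintype.card (Set.range P)) : ℝ) / Real.log 5) with hh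
  have hlt : h < R := by
    refine lt_of_le_of_lt ?_ hR
    rw [hh]
    gcongr
    rcases isEmpty_or_nonempty A with hA | hA
    · have : IsEmpty (Set.range P) := by simpa using hA
      simp [Fintype.card_eq_zero]
    · refine (harmonic_le_one_add_log _).trans ?_
      have hpos : 0 < Fintype.card (Set.range P) := Fintype.card_pos
      gcongr
      exact Fintype.card_le_of_surjective (Set.rangeFactorization P) Set.rangeFactorization_surjective
  obtain ⟨ε, hε, hεR⟩ : ∃ ε > 0, (1 + ε) * h + ε < R := by
    have ht : Filter.Tendsto (fun ε : ℝ => (1 + ε) * h + ε) (nhdsWithin 0 (Set.Ioi 0))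
        (nhds ((1 + 0) * h + 0)) := by
      refine Filter.Tendsto.mono_left ?_ nhdsWithin_le_nhds
      exact Continuous.tendsto (by fun_prop) 0
    have := (ht.eventually_lt_const (by simpa using hlt)).and self_mem_nhdsWithin
    obtain ⟨ε, h1, h2⟩ := this.exists
    exact ⟨ε, h2, h1⟩
  have hprob : ∀ Q : Set.range P, IsProbabilityMeasure (Q : Measure X) := by
    rintro ⟨_, a, rfl⟩
    infer_instance
  have := exists_hasCoupling_of_injective (fun Q : Set.range P => (Q : Measure X))
    Subtype.val_injective hε
  refine (this.comap (Set.rangeFactorization P)).mono fun a b => ?_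
  simp only [Set.rangeFactorization_coe]
  gcongr

theorem map_projIcc_stdSpace :
    stdSpace.map (Set.projIcc (0 : ℝ) 1 zero_le_one) = (volume : Measure unitInterval) := by
  rw [stdSpace, ← unitInterval.measurePreserving_coe.map_eq,
    Measure.map_map (by fun_prop) (by fun_prop)]
  have hid : Set.projIcc (0 : ℝ) 1 zero_le_one ∘ ((↑) : unitInterval → ℝ) = id :=
    funext fun x => Set.projIcc_val zero_le_one x
  rw [hid, Measure.map_id]

theorem HasCoupling.optRatio_le {P : A → Measure X} {R : ℝ≥0∞} (hR : 1 ≤ R) [Nonempty X]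
    (h : HasCoupling P fun a b => R * wass (P a) (P b)) :
    optRatio (fun x y : X => dist x y) P ≤ R := by
  obtain ⟨μ, hμ, hmarg, hcost⟩ := h
  obtain ⟨g, hg, hgμ⟩ := μ.exists_measurable_map_eq
  set G : ℝ → A → X := g ∘ Set.projIcc (0 : ℝ) 1 zero_le_one with hG
  have hproj : Measurable (Set.projIcc (0 : ℝ) 1 zero_le_one) := continuous_projIcc.measurable
  have hGm : Measurable G := hg.comp hproj
  have hGμ : stdSpace.map G = μ := by
    rw [← hgμ, ← map_projIcc_stdSpace, Measure.map_map hg hproj]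
  refine iInf₂_le_of_le (fun a u => G u a) ⟨fun a => (measurable_pi_apply a).comp hGm,
    fun a => ?_⟩ (sInf_le ⟨hR, fun a b => ?_⟩)
  · rw [← hmarg a, ← hGμ, Measure.map_map (by fun_prop) hGm]
    rfl
  · refine le_trans (le_of_eq ?_) (hcost a b)
    rw [← hGμ, lintegral_map (by fun_prop) hGm]
    simp only [edist_dist]

end Main

theorem fifteen_mul_one_add_log_div_lt {n : ℕ} (hn : 2 ≤ n) :
    15 * ((1 + Real.log n) / Real.log 5) < 23.1 * Real.log n := by
  have h5 := Real.log_five_gt_d9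
  have h2 := Real.log_two_gt_d9
  have hlog : Real.log 2 ≤ Real.log n := Real.log_le_log (by norm_num) (by exact_mod_cast hn)
  rw [← mul_div_assoc, div_lt_iff₀ (by linarith)]
  nlinarith

/-- for a complete separable metric space `(X, c)` with at least two
points (whose metric `c` serves as the cost) and a finite family `{P_α}_{α ∈ A}` of
Borel probability measures on `X` with `|A| ≥ 2`, the optimal pairwise coupling ratio
satisfies `r*_c({P_α}) < 23.1 log |A|`. -/
theorem finite_family_optRatio_lt {X : Type*} [MetricSpace X] [CompleteSpace X]
    [TopologicalSpace.SeparableSpace X] [Nontrivial X] [MeasurableSpace X] [BorelSpace X]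
    {A : Type*} [Fintype A] (hA : 2 ≤ Fintype.card A)
    (P : A → Measure X) (hP : ∀ a, IsProbabilityMeasure (P a)) :
    optRatio (fun x y : X => dist x y) P
      < ENNReal.ofReal (23.1 * Real.log (Fintype.card A)) := by
  have : SecondCountableTopology X := UniformSpace.secondCountable_of_separable X
  have hlt := fifteen_mul_one_add_log_div_lt hA
  obtain ⟨R, hR, hR'⟩ := exists_between hlt
  have hlog : Real.log 2 ≤ Real.log (Fintype.card A) :=
    Real.log_le_log (by norm_num) (by exact_mod_cast hA)
  have h1 : 1 ≤ R := by
    refine le_trans ?_ hR.le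
    rw [← mul_div_assoc, le_div_iff₀ (Real.log_pos (by norm_num))]
    linarith [Real.log_five_lt_d9, Real.log_two_gt_d9]
  refine (exists_hasCoupling P hR).optRatio_le (by simpa using h1) |>.trans_lt ?_
  exact (ENNReal.ofReal_lt_ofReal_iff (by linarith)).2 hR'

end
end

section
/- Let X be a Polish space and c a symmetric cost function on X. Then for every integer k ≥ 2 and every sequence of points x_1, …, x_k ∈ X (with x_{k+1} := x_1), r*_c(P(X)) ≥ 2(k − 1)·min_{1 ≤ i < j ≤ k} c(x_i, x_j) / ( Σ_{i=1}^k c(x_i, x_{i+1}) ), with the conventions a/0 = ∞ for a > 0 and 0/0 = 0. -/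
open MeasureTheory ENNReal

noncomputable section

/-- The uniform distribution on a finite set of points (the zero measure if it is empty). -/
def uniformOnFinset {Y : Type*} [MeasurableSpace Y] (s : Finset Y) : Measure Y :=
  (s.card : ℝ≥0∞)⁻¹ • ∑ y ∈ s, Measure.dirac y

lemma isProbabilityMeasure_uniformOnFinset {Y : Type*} [MeasurableSpace Y] {s : Finset Y}
    (hs : s.Nonempty) : IsProbabilityMeasure (uniformOnFinset s) := by
  constructor
  simp only [uniformOnFinset, Measure.smul_apply, Measure.finsetSum_apply, measure_univ,
    Finset.sum_const, nsmul_eq_mul, mul_one, smul_eq_mul]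
  exact ENNReal.inv_mul_cancel (by simpa using hs.ne_empty) (by simp)

lemma map_uniformOnFinset {Y Z : Type*} [MeasurableSpace Y] [MeasurableSpace Z] [DecidableEq Z]
    (s : Finset Y) {g : Y → Z} (hg : Measurable g) (hinj : Set.InjOn g s) :
    (uniformOnFinset s).map g = uniformOnFinset (s.image g) := by
  simp only [uniformOnFinset, Measure.map_smul, Finset.card_image_of_injOn hinj,
    Finset.sum_image hinj]
  congr 1
  rw [← Measure.mapₗ_apply_of_measurable hg, map_sum]
  exact Finset.sum_congr rfl fun y _ => by
    rw [Measure.mapₗ_apply_of_measurable hg, Measure.map_dirac' hg]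

lemma ae_mem_uniformOnFinset {Y : Type*} [MeasurableSpace Y] [MeasurableSingletonClass Y]
    (s : Finset Y) : ∀ᵐ y ∂uniformOnFinset s, y ∈ s := by
  refine Measure.ae_smul_measure ?_ _
  rw [ae_iff, Measure.finsetSum_apply]
  refine Finset.sum_eq_zero fun y hy => ?_
  rw [← ae_iff, ae_dirac_eq]
  exact hy

lemma Cstar_uniformOnFinset_erase_le {X : Type*} [MeasurableSpace X]
    [MeasurableSingletonClass X] [DecidableEq X] (c : X → X → ℝ)
    (hdiag : ∀ x : X, c x x = 0) {s : Finset X} {y z : X} (hy : y ∈ s) (hz : z ∈ s)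
    (hyz : y ≠ z) :
    Cstar c (uniformOnFinset (s.erase y)) (uniformOnFinset (s.erase z))
      ≤ ((s.card - 1 : ℕ) : ℝ≥0∞)⁻¹ * ENNReal.ofReal (c z y) := by
  have hmem : z ∈ s.erase y := Finset.mem_erase.2 ⟨hyz.symm, hz⟩
  set g : X → X × X := fun w => (w, Equiv.swap y z w) with hgdef
  have hginj : Set.InjOn g (s.erase y) := fun a _ b _ h => (Prod.ext_iff.1 h).1
  set t : Finset (X × X) := (s.erase y).image g with ht
  have hcard : t.card = s.card - 1 := by
    rw [ht, Finset.card_image_of_injOn hginj, Finset.card_erase_of_mem hy]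
  have himg_fst : t.image Prod.fst = s.erase y := by
    rw [ht, Finset.image_image]
    exact Finset.image_id
  have himg_snd : t.image Prod.snd = s.erase z := by
    rw [ht, Finset.image_image]
    ext w
    simp only [Finset.mem_image, Finset.mem_erase, Function.comp_apply, hgdef]
    constructor
    · rintro ⟨a, ⟨hay, has⟩, rfl⟩
      rw [Equiv.swap_apply_def]
      grind
    · rintro ⟨hwz, hws⟩
      refine ⟨Equiv.swap y z w, ?_, by simp⟩
      rw [Equiv.swap_apply_def]
      grind
  have hinj_fst : Set.InjOn Prod.fst (t : Set (X × X)) := by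
    rw [ht, Finset.coe_image]
    rintro _ ⟨a, _, rfl⟩ _ ⟨b, _, rfl⟩ h
    exact congrArg g h
  have hinj_snd : Set.InjOn Prod.snd (t : Set (X × X)) := by
    rw [ht, Finset.coe_image]
    rintro _ ⟨a, _, rfl⟩ _ ⟨b, _, rfl⟩ h
    exact congrArg g ((Equiv.swap y z).injective h)
  have hprob : IsProbabilityMeasure (uniformOnFinset t) :=
    isProbabilityMeasure_uniformOnFinset (Finset.Nonempty.image ⟨z, hmem⟩ g)
  have hfst : (uniformOnFinset t).map Prod.fst = uniformOnFinset (s.erase y) := by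
    rw [map_uniformOnFinset t measurable_fst hinj_fst, himg_fst]
  have hsnd : (uniformOnFinset t).map Prod.snd = uniformOnFinset (s.erase z) := by
    rw [map_uniformOnFinset t measurable_snd hinj_snd, himg_snd]
  refine (iInf₂_le (uniformOnFinset t) ⟨hprob, hfst, hsnd⟩).trans ?_
  rw [uniformOnFinset, hcard, lintegral_smul_measure, lintegral_finsetSum_measure, smul_eq_mul]
  simp only [lintegral_dirac]
  rw [ht, Finset.sum_image hginj, Finset.sum_eq_single_of_mem z hmem]
  · simp [hgdef]
  · intro w hw hwz
    simp [hgdef, Equiv.swap_apply_of_ne_of_ne (Finset.ne_of_mem_erase hw) hwz, hdiag]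

/-- A closed walk `g` of length `k` which is not constant changes its value at some step other
than any prescribed one. -/
lemma exists_ne_step_of_cycle {Y : Type*} {k : ℕ} {g : ℕ → Y} (hcyc : g (k + 1) = g 1)
    (hne : ∃ j, 1 ≤ j ∧ j ≤ k ∧ g j ≠ g 1) (i₀ : ℕ) :
    ∃ i, 1 ≤ i ∧ i ≤ k ∧ i ≠ i₀ ∧ g i ≠ g (i + 1) := by
  by_contra! h
  obtain ⟨j, hj1, hjk, hj⟩ := hne
  have hstart : ∀ n, 1 ≤ n → n ≤ k → n ≤ i₀ → g n = g 1 := by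
    intro n hn
    induction n, hn using Nat.le_induction with
    | base => intros; rfl
    | succ n hn ih =>
      intro hnk hni
      rw [← h n hn (by omega) (by omega), ih (by omega) (by omega)]
  have hend : ∀ n, n ≤ k → i₀ < n → 1 ≤ n → g n = g (k + 1) := by
    intro n hn
    induction hn using Nat.decreasingInduction with
    | self => exact fun hi hk => h k hk le_rfl hi.ne'
    | of_succ n hn ih =>
      intro hi h1
      rw [h n h1 (by omega) (by omega), ih (by omega) (by omega)]
  rcases le_or_gt j i₀ with hji | hji
  · exact hj (hstart j hj1 hjk hji)
  · exact hj ((hend j hjk hji hj1).trans hcyc)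

/-- A nonconstant closed walk on points at mutual cost at least `m` has total cost at least
`2 * m`. -/
lemma two_mul_le_sum_of_cycle {Y : Type*} (C : Y → Y → ℝ≥0∞) (m : ℝ≥0∞) {k : ℕ} {g : ℕ → Y}
    (hcyc : g (k + 1) = g 1) (hne : ∃ j, 1 ≤ j ∧ j ≤ k ∧ g j ≠ g 1)
    (hm : ∀ i, 1 ≤ i → i ≤ k → g i ≠ g (i + 1) → m ≤ C (g i) (g (i + 1))) :
    2 * m ≤ ∑ i ∈ Finset.Icc 1 k, C (g i) (g (i + 1)) := by
  obtain ⟨a, ha1, hak, -, ha⟩ := exists_ne_step_of_cycle hcyc hne 0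
  obtain ⟨b, hb1, hbk, hba, hb⟩ := exists_ne_step_of_cycle hcyc hne a
  calc 2 * m ≤ C (g a) (g (a + 1)) + C (g b) (g (b + 1)) := by
        rw [two_mul]
        exact add_le_add (hm a ha1 hak ha) (hm b hb1 hbk hb)
    _ = ∑ i ∈ {a, b}, C (g i) (g (i + 1)) :=
        (Finset.sum_pair (f := fun i => C (g i) (g (i + 1))) hba.symm).symm
    _ ≤ _ := Finset.sum_le_sum_of_subset (by
        intro i hi
        simp only [Finset.mem_insert, Finset.mem_singleton] at hi
        rcases hi with rfl | rfl <;> simp [*])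

/-- cycle lower bound. For a Polish space `X`, a symmetric cost
function `c`, an integer `k ≥ 2`, points `x_1, …, x_k ∈ X` with `x_{k+1} := x_1`, and
`m = min_{1 ≤ i < j ≤ k} c(x_i, x_j)`, one has
`r*_c(P(X)) ≥ 2(k-1) m / (∑_{i=1}^k c(x_i, x_{i+1}))`, with `a/0 = ∞` for `a > 0` and
`0/0 = 0` (these are the conventions of `ℝ≥0∞` division). -/
theorem optRatio_cycle_lower_bound {X : Type*} [TopologicalSpace X] [PolishSpace X]
    [MeasurableSpace X] [BorelSpace X]
    (c : X → X → ℝ) (hmeas : Measurable (Function.uncurry c))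
    (hsymm : ∀ x y : X, c x y = c y x) (hdiag : ∀ x : X, c x x = 0)
    (hnonneg : ∀ x y : X, 0 ≤ c x y) (hnontriv : ∃ x y : X, c x y ≠ 0)
    (k : ℕ) (hk : 2 ≤ k) (x : ℕ → X) (hcyc : x (k + 1) = x 1)
    (m : ℝ) (hm : IsLeast {d : ℝ | ∃ i j : ℕ, 1 ≤ i ∧ i < j ∧ j ≤ k ∧ d = c (x i) (x j)} m) :
    ENNReal.ofReal (2 * ((k : ℝ) - 1) * m) /
        ENNReal.ofReal (∑ i ∈ Finset.Icc 1 k, c (x i) (x (i + 1)))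
      ≤ optRatio c (fun P : ProbabilityMeasure X => (P : Measure X)) := by
  classical
  rcases le_or_gt m 0 with hm0 | hm0
  · rw [ENNReal.ofReal_of_nonpos, ENNReal.zero_div]
    · exact zero_le
    · have : (2 : ℝ) ≤ k := by exact_mod_cast hk
      exact mul_nonpos_of_nonneg_of_nonpos (by linarith) hm0
  have hlt : ∀ i j, 1 ≤ i → i < j → j ≤ k → m ≤ c (x i) (x j) :=
    fun i j hi hij hj => hm.2 ⟨i, j, hi, hij, hj, rfl⟩
  have hxinj : Set.InjOn x (Finset.Icc 1 k) := by
    intro i hi j hj hij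
    rw [Finset.mem_coe, Finset.mem_Icc] at hi hj
    by_contra hne
    rcases Nat.lt_or_gt_of_ne hne with h | h
    · have := hlt i j hi.1 h hj.2
      rw [hij, hdiag] at this
      linarith
    · have := hlt j i hj.1 h hi.2
      rw [hij, hdiag] at this
      linarith
  set s : Finset X := (Finset.Icc 1 k).image x with hs
  have hcard : s.card = k := by simp [hs, Finset.card_image_of_injOn hxinj]
  have hxs : ∀ i, 1 ≤ i → i ≤ k + 1 → x i ∈ s := by
    intro i h1 h2
    rcases Nat.lt_or_ge k i with h | h
    · obtain rfl : i = k + 1 := by omega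
      rw [hcyc]
      exact Finset.mem_image_of_mem _ (Finset.mem_Icc.2 ⟨le_rfl, by omega⟩)
    · exact Finset.mem_image_of_mem _ (Finset.mem_Icc.2 ⟨h1, h⟩)
  have hsm : ∀ y ∈ s, ∀ z ∈ s, y ≠ z → m ≤ c y z := by
    intro y hy z hz hyz
    obtain ⟨i, hi, rfl⟩ := Finset.mem_image.1 hy
    obtain ⟨j, hj, rfl⟩ := Finset.mem_image.1 hz
    rw [Finset.mem_Icc] at hi hj
    rcases lt_trichotomy i j with h | h | h
    · exact hlt i j hi.1 h hj.2
    · exact absurd (congrArg x h) hyz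
    · rw [hsymm]
      exact hlt j i hj.1 h hi.2
  have hstep : ∀ i, 1 ≤ i → i ≤ k → x i ≠ x (i + 1) := by
    intro i h1 h2 h
    rcases h2.lt_or_eq with h3 | rfl
    · have := hxinj (by simp; omega) (by simp; omega) h
      omega
    · rw [hcyc] at h
      have := hxinj (by simp; omega) (by simp; omega) h
      omega
  have hprob : ∀ y, IsProbabilityMeasure (uniformOnFinset (s.erase y)) := fun y =>
    isProbabilityMeasure_uniformOnFinset <| Finset.card_pos.1 <| by
      have := Finset.pred_card_le_card_erase (s := s) (a := y)
      omega
  let p : X → ProbabilityMeasure X := fun y => ⟨uniformOnFinset (s.erase y), hprob y⟩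
  refine le_iInf₂ fun f hf => le_sInf ?_
  rintro r ⟨-, hr⟩
  refine ENNReal.div_le_of_le_mul ?_
  have hae : ∀ y, ∀ᵐ u ∂stdSpace, f (p y) u ∈ s.erase y := by
    intro y
    refine ae_of_ae_map (hf.measurable (p y)).aemeasurable (p := fun w => w ∈ s.erase y) ?_
    rw [hf.law]
    exact ae_mem_uniformOnFinset _
  have hlower : 2 * ENNReal.ofReal m ≤ ∑ i ∈ Finset.Icc 1 k,
      ∫⁻ u, ENNReal.ofReal (c (f (p (x i)) u) (f (p (x (i + 1))) u)) ∂stdSpace := by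
    have hvol : stdSpace Set.univ = 1 := by simp [stdSpace]
    rw [← lintegral_finsetSum]
    · calc 2 * ENNReal.ofReal m = ∫⁻ _, 2 * ENNReal.ofReal m ∂stdSpace := by
            rw [lintegral_const, hvol, mul_one]
        _ ≤ _ := lintegral_mono_ae ?_
      filter_upwards [ae_all_iff.2 fun i => hae (x i)] with u hu
      refine two_mul_le_sum_of_cycle (fun y z => ENNReal.ofReal (c y z)) (ENNReal.ofReal m)
        (g := fun i => f (p (x i)) u) (by simp only [hcyc]) ?_ ?_
      · obtain ⟨j, hj, hj1⟩ := Finset.mem_image.1 (Finset.mem_of_mem_erase (hu 1))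
        rw [Finset.mem_Icc] at hj
        exact ⟨j, hj.1, hj.2, fun h => Finset.ne_of_mem_erase (hu j) (h.trans hj1.symm)⟩
      · intro i _ _ hne
        exact ENNReal.ofReal_le_ofReal (hsm _ (Finset.mem_of_mem_erase (hu i)) _
          (Finset.mem_of_mem_erase (hu (i + 1))) hne)
    · intro i _
      exact (hmeas.comp ((hf.measurable _).prodMk (hf.measurable _))).ennreal_ofReal
  have hupper : ∀ i ∈ Finset.Icc 1 k,
      ∫⁻ u, ENNReal.ofReal (c (f (p (x i)) u) (f (p (x (i + 1))) u)) ∂stdSpace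
        ≤ r * (((k - 1 : ℕ) : ℝ≥0∞)⁻¹ * ENNReal.ofReal (c (x i) (x (i + 1)))) := by
    intro i hi
    rw [Finset.mem_Icc] at hi
    refine (hr _ _).trans ?_
    have := Cstar_uniformOnFinset_erase_le c hdiag (hxs i hi.1 (by omega))
      (hxs (i + 1) (by omega) (by omega)) (hstep i hi.1 hi.2)
    rw [hcard, hsymm] at this
    gcongr
    exact this
  have hmain := hlower.trans (Finset.sum_le_sum hupper)
  rw [← Finset.mul_sum, ← Finset.mul_sum,
    ← ENNReal.ofReal_sum_of_nonneg fun i _ => hnonneg _ _] at hmain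
  have hkcast : (k : ℝ) - 1 = ((k - 1 : ℕ) : ℝ) := by
    rw [Nat.cast_sub (by omega), Nat.cast_one]
  have hlhs : ENNReal.ofReal (2 * ((k : ℝ) - 1) * m)
      = ((k - 1 : ℕ) : ℝ≥0∞) * (2 * ENNReal.ofReal m) := by
    rw [hkcast, ENNReal.ofReal_mul (by positivity), ENNReal.ofReal_mul (by positivity),
      ENNReal.ofReal_natCast, ENNReal.ofReal_ofNat]
    ring
  have hk0 : ((k - 1 : ℕ) : ℝ≥0∞) ≠ 0 := by
    rw [Nat.cast_ne_zero]
    omega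
  rw [hlhs]
  refine (mul_le_mul_right hmain _).trans_eq ?_
  rw [mul_left_comm, ← mul_assoc (((k - 1 : ℕ) : ℝ≥0∞)),
    ENNReal.mul_inv_cancel hk0 (ENNReal.natCast_ne_top _), one_mul]

end
end

section
/- Let X be a Polish space and c a symmetric cost function on X. Let k ≥ 1 be an integer and let x_1, …, x_{2k} ∈ X, with x_{2k+1} := x_1, satisfy c(x_i, x_{i+k+1}) + c(x_{i+k}, x_{i+1}) > c(x_i, x_{i+1}) + c(x_{i+k}, x_{i+k+1}) for every i = 1, …, k. Then r*_c(P(X)) ≥ ( Σ_{i=1}^k [ c(x_i, x_{i+1}) + c(x_{i+k}, x_{i+k+1}) ] / [ c(x_i, x_{i+k+1}) + c(x_{i+k}, x_{i+1}) − c(x_i, x_{i+1}) − c(x_{i+k}, x_{i+k+1}) ] )^{−1} + 1, with the convention that the right-hand side equals ∞ + 1 := ∞ if the sum in the denominator is 0. -/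
open MeasureTheory ENNReal

noncomputable section

/-- The uniform distribution on the pair of points `a`, `b`, with multiplicity if `a = b`. -/
def pairMeasure {X : Type*} [MeasurableSpace X] (a b : X) : Measure X :=
  (2⁻¹ : ℝ≥0∞) • Measure.dirac a + (2⁻¹ : ℝ≥0∞) • Measure.dirac b

instance {X : Type*} [MeasurableSpace X] (a b : X) : IsProbabilityMeasure (pairMeasure a b) :=
  ⟨by simp [pairMeasure, ENNReal.inv_two_add_inv_two]⟩

theorem pairMeasure_comm {X : Type*} [MeasurableSpace X] (a b : X) :
    pairMeasure a b = pairMeasure b a :=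
  add_comm _ _

theorem map_pairMeasure {X Y : Type*} [MeasurableSpace X] [MeasurableSpace Y] {g : X → Y}
    (hg : Measurable g) (a b : X) : (pairMeasure a b).map g = pairMeasure (g a) (g b) := by
  simp [pairMeasure, Measure.map_add _ _ hg, Measure.map_smul, Measure.map_dirac' hg]

theorem lintegral_pairMeasure {X : Type*} [MeasurableSpace X] [MeasurableSingletonClass X]
    (g : X → ℝ≥0∞) (a b : X) : ∫⁻ z, g z ∂pairMeasure a b = 2⁻¹ * g a + 2⁻¹ * g b := by
  simp [pairMeasure]

/-- The straight coupling bounds the transport cost between two uniform pair distributions. -/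
theorem Cstar_pairMeasure_le {X : Type*} [MeasurableSpace X] [MeasurableSingletonClass X]
    (c : X → X → ℝ) (hnonneg : ∀ x y, 0 ≤ c x y) (a a' b b' : X) :
    Cstar c (pairMeasure a a') (pairMeasure b b')
      ≤ ENNReal.ofReal ((c a b + c a' b') / 2) := by
  refine (iInf₂_le (pairMeasure (a, b) (a', b'))
    ⟨inferInstance, map_pairMeasure measurable_fst _ _,
      map_pairMeasure measurable_snd _ _⟩).trans_eq ?_
  rw [lintegral_pairMeasure, ← mul_add, ← ENNReal.ofReal_add (hnonneg _ _) (hnonneg _ _),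
    div_eq_inv_mul, ENNReal.ofReal_mul (by norm_num), ENNReal.ofReal_inv_of_pos two_pos,
    ENNReal.ofReal_ofNat]

section TwoPoint

variable {Ω X : Type*} [MeasurableSpace Ω] [MeasurableSpace X] [MeasurableSingletonClass X]
  {μ : Measure Ω} {Y Z : Ω → X} {a a' b b' : X}

theorem ae_eq_or_eq_of_map_eq_pairMeasure (hY : Measurable Y)
    (hlaw : μ.map Y = pairMeasure a a') : ∀ᵐ u ∂μ, Y u = a ∨ Y u = a' := by
  have h : ∀ᵐ y ∂μ.map Y, y = a ∨ y = a' := by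
    rw [hlaw, pairMeasure, ae_add_measure_iff]
    exact ⟨Measure.ae_smul_measure (by simp [ae_dirac_eq]) _,
      Measure.ae_smul_measure (by simp [ae_dirac_eq]) _⟩
  exact ae_of_ae_map hY.aemeasurable h

theorem measureReal_eq_half_of_map_eq_pairMeasure (hY : Measurable Y)
    (hlaw : μ.map Y = pairMeasure a a') (ha : a ≠ a') : μ.real {u | Y u = a} = 1 / 2 := by
  have h : μ.map Y {a} = 2⁻¹ := by
    rw [hlaw]; simp [pairMeasure, ha.symm]
  rw [Measure.map_apply hY (measurableSet_singleton a)] at h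
  change (μ (Y ⁻¹' {a})).toReal = _
  rw [h]; simp

/-- The expected cost between two uniform two-valued variables, in terms of the probability that
they are matched crosswise. -/
theorem lintegral_cost_eq_of_map_eq_pairMeasure [IsProbabilityMeasure μ] (c : X → X → ℝ)
    (hnonneg : ∀ x y, 0 ≤ c x y) (hY : Measurable Y) (hZ : Measurable Z)
    (hYlaw : μ.map Y = pairMeasure a a') (hZlaw : μ.map Z = pairMeasure b b')
    (ha : a ≠ a') (hb : b ≠ b') :
    ∫⁻ u, ENNReal.ofReal (c (Y u) (Z u)) ∂μ
      = ENNReal.ofReal ((c a b + c a' b') / 2 + μ.real (symmDiff {u | Y u = a} {u | Z u = b})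
          * ((c a b' + c a' b - c a b - c a' b') / 2)) := by
  set E := {u | Y u = a} with hE
  set F := {u | Z u = b} with hF
  have mE : MeasurableSet E := hY (measurableSet_singleton a)
  have mF : MeasurableSet F := hZ (measurableSet_singleton b)
  have hEr : μ.real E = 1 / 2 := measureReal_eq_half_of_map_eq_pairMeasure hY hYlaw ha
  have hFr : μ.real F = 1 / 2 := measureReal_eq_half_of_map_eq_pairMeasure hZ hZlaw hb
  set h : Ω → ℝ := (E ∩ F).indicator (fun _ => c a b) + (E \ F).indicator (fun _ => c a b')
    + ((F \ E).indicator (fun _ => c a' b) + (E ∪ F)ᶜ.indicator fun _ => c a' b') with hh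
  have hae : ∀ᵐ u ∂μ, c (Y u) (Z u) = h u := by
    filter_upwards [ae_eq_or_eq_of_map_eq_pairMeasure hY hYlaw,
      ae_eq_or_eq_of_map_eq_pairMeasure hZ hZlaw] with u hu hv
    rcases hu with hu | hu <;> rcases hv with hv | hv <;>
      simp [hh, hE, hF, Set.indicator, hu, hv, ha.symm, hb.symm]
  have hint (S : Set Ω) (mS : MeasurableSet S) (t : ℝ) :
      Integrable (S.indicator fun _ => t) μ := (integrable_const t).indicator mS
  have i1 := hint _ (mE.inter mF) (c a b)
  have i2 := hint _ (mE.diff mF) (c a b')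
  have i3 := hint _ (mF.diff mE) (c a' b)
  have i4 := hint _ (mE.union mF).compl (c a' b')
  have hinth : ∫ u, h u ∂μ = μ.real (E ∩ F) * c a b + μ.real (E \ F) * c a b'
      + (μ.real (F \ E) * c a' b + μ.real (E ∪ F)ᶜ * c a' b') := by
    rw [hh, integral_add' (i1.add i2) (i3.add i4), integral_add' i1 i2, integral_add' i3 i4,
      integral_indicator_const _ (mE.inter mF), integral_indicator_const _ (mE.diff mF),
      integral_indicator_const _ (mF.diff mE), integral_indicator_const _ (mE.union mF).compl]
    simp only [smul_eq_mul]
  have hpos : 0 ≤ᵐ[μ] h := by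
    filter_upwards [hae] with u hu
    rw [← hu]; exact hnonneg _ _
  rw [lintegral_congr_ae (hae.mono fun u hu => congrArg ENNReal.ofReal hu),
    ← ofReal_integral_eq_lintegral_ofReal ((i1.add i2).add (i3.add i4)) hpos, hinth]
  congr 1
  have e1 := measureReal_inter_add_sdiff (μ := μ) (s := E) mF
  have e2 := measureReal_inter_add_sdiff (μ := μ) (s := F) mE
  have e3 := measureReal_union_add_inter (μ := μ) (s := E) mF
  have e4 := probReal_compl_eq_one_sub (μ := μ) (mE.union mF)
  have e5 : μ.real (symmDiff E F) = μ.real (E \ F) + μ.real (F \ E) := by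
    rw [Set.symmDiff_def]
    exact measureReal_union disjoint_sdiff_sdiff (mF.diff mE)
  rw [Set.inter_comm F E] at e2
  have f1 : μ.real (E \ F) = 1 / 2 - μ.real (E ∩ F) := by linarith
  have f2 : μ.real (F \ E) = 1 / 2 - μ.real (E ∩ F) := by linarith
  have f3 : μ.real (E ∪ F)ᶜ = μ.real (E ∩ F) := by linarith
  rw [e5, f3, f1, f2]
  ring

end TwoPoint

/-- two-point-pair lower bound. For a Polish space `X`, a symmetric
cost function `c`, an integer `k ≥ 1`, and points `x_1, …, x_{2k} ∈ X` with
`x_{2k+1} := x_1` satisfying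
`c(x_i, x_{i+k+1}) + c(x_{i+k}, x_{i+1}) > c(x_i, x_{i+1}) + c(x_{i+k}, x_{i+k+1})` for
all `i = 1, …, k`, one has
`r*_c(P(X)) ≥ (∑_{i=1}^k [c(x_i,x_{i+1}) + c(x_{i+k},x_{i+k+1})] /
  [c(x_i,x_{i+k+1}) + c(x_{i+k},x_{i+1}) − c(x_i,x_{i+1}) − c(x_{i+k},x_{i+k+1})])⁻¹ + 1`,
where the right-hand side is `∞` when the sum vanishes (the convention of `ℝ≥0∞`). -/
theorem optRatio_pair_cycle_lower_bound {X : Type*} [TopologicalSpace X] [PolishSpace X]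
    [MeasurableSpace X] [BorelSpace X]
    (c : X → X → ℝ) (hmeas : Measurable (Function.uncurry c))
    (hsymm : ∀ x y : X, c x y = c y x) (hdiag : ∀ x : X, c x x = 0)
    (hnonneg : ∀ x y : X, 0 ≤ c x y) (hnontriv : ∃ x y : X, c x y ≠ 0)
    (k : ℕ) (hk : 1 ≤ k) (x : ℕ → X) (hcyc : x (2 * k + 1) = x 1)
    (hcond : ∀ i ∈ Finset.Icc 1 k,
      c (x i) (x (i + 1)) + c (x (i + k)) (x (i + k + 1))
        < c (x i) (x (i + k + 1)) + c (x (i + k)) (x (i + 1))) :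
    (ENNReal.ofReal (∑ i ∈ Finset.Icc 1 k,
          (c (x i) (x (i + 1)) + c (x (i + k)) (x (i + k + 1))) /
            (c (x i) (x (i + k + 1)) + c (x (i + k)) (x (i + 1))
              - c (x i) (x (i + 1)) - c (x (i + k)) (x (i + k + 1)))))⁻¹ + 1
      ≤ optRatio c (fun P : ProbabilityMeasure X => (P : Measure X)) := by
  have hne : ∀ i ∈ Finset.Icc 1 k, x i ≠ x (i + k) := by
    intro i hi h
    have := hcond i hi
    rw [← h] at this
    linarith
  have hne' : ∀ i ∈ Finset.Icc 1 k, x (i + 1) ≠ x (i + k + 1) := by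
    intro i hi h
    have := hcond i hi
    rw [← h] at this
    linarith
  set S := ∑ i ∈ Finset.Icc 1 k,
    (c (x i) (x (i + 1)) + c (x (i + k)) (x (i + k + 1))) /
      (c (x i) (x (i + k + 1)) + c (x (i + k)) (x (i + 1))
        - c (x i) (x (i + 1)) - c (x (i + k)) (x (i + k + 1))) with hS
  refine le_iInf₂ fun f hf => le_sInf fun r ⟨hr, hrle⟩ => ?_
  rcases eq_or_ne r ∞ with rfl | hrtop
  · exact le_top
  lift r to NNReal using hrtop
  have hr1 : (1 : ℝ) ≤ r := by exact_mod_cast hr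
  let P : ℕ → ProbabilityMeasure X := fun i => ⟨pairMeasure (x i) (x (i + k)), inferInstance⟩
  have hP : P (k + 1) = P 1 := by
    apply Subtype.ext
    change pairMeasure _ _ = pairMeasure _ _
    rw [pairMeasure_comm, show k + 1 + k = 2 * k + 1 by ring, hcyc, add_comm k 1]
  have hlaw (i : ℕ) : stdSpace.map (f (P i)) = pairMeasure (x i) (x (i + k)) := hf.law (P i)
  let E : ℕ → Set ℝ := fun i => {u | f (P i) u = x i}
  have hcross : ∀ i ∈ Finset.Icc 1 k, stdSpace.real (symmDiff (E i) (E (i + 1))) ≤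
      (r - 1) * ((c (x i) (x (i + 1)) + c (x (i + k)) (x (i + k + 1))) /
        (c (x i) (x (i + k + 1)) + c (x (i + k)) (x (i + 1))
          - c (x i) (x (i + 1)) - c (x (i + k)) (x (i + k + 1)))) := by
    intro i hi
    have hlaw' := hlaw (i + 1)
    rw [add_right_comm] at hlaw'
    have hPi : (P (i + 1) : Measure X) = pairMeasure (x (i + 1)) (x (i + k + 1)) := by
      rw [add_right_comm]; rfl
    have h := (hrle (P i) (P (i + 1))).trans (mul_le_mul_right
      ((congrArg (Cstar c _) hPi).trans_le
        (Cstar_pairMeasure_le c hnonneg (x i) (x (i + k)) _ _)) _)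
    rw [lintegral_cost_eq_of_map_eq_pairMeasure c hnonneg (hf.measurable _) (hf.measurable _)
      (hlaw i) hlaw' (hne i hi) (hne' i hi), ← ENNReal.ofReal_coe_nnreal,
      ← ENNReal.ofReal_mul r.coe_nonneg, ENNReal.ofReal_le_ofReal_iff] at h
    · have := hcond i hi
      rw [← mul_div_assoc, le_div_iff₀ (by linarith)]
      change _ + stdSpace.real (symmDiff (E i) (E (i + 1))) * _ ≤ _ at h
      linarith
    · have := hnonneg (x i) (x (i + 1))
      have := hnonneg (x (i + k)) (x (i + k + 1))
      positivity
  have hcover : ∀ᵐ u ∂stdSpace, u ∈ ⋃ i ∈ Finset.Icc 1 k, symmDiff (E i) (E (i + 1)) := by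
    filter_upwards [ae_eq_or_eq_of_map_eq_pairMeasure (hf.measurable _) (hlaw 1)] with u hu
    by_contra hnot
    simp only [Set.mem_iUnion, not_exists, Set.mem_symmDiff] at hnot
    have hchain : ∀ j ≤ k, (u ∈ E 1 ↔ u ∈ E (j + 1)) := by
      intro j
      induction j with
      | zero => simp
      | succ j ih =>
        intro hj
        have := hnot (j + 1) (Finset.mem_Icc.2 ⟨by omega, hj⟩)
        have := ih (by omega)
        tauto
    have h1 := hchain k le_rfl
    have h2 := hne 1 (Finset.mem_Icc.2 ⟨le_rfl, hk⟩)
    simp only [E, Set.mem_ofPred_eq, hP] at h1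
    rw [add_comm k 1] at h1
    rcases hu with hu | hu <;> rw [hu] at h1
    · exact h2 (h1.1 rfl)
    · exact h2 (h1.2 rfl).symm
  have hone : 1 ≤ (r - 1 : ℝ) * S :=
    calc (1 : ℝ) = stdSpace.real (⋃ i ∈ Finset.Icc 1 k, symmDiff (E i) (E (i + 1))) := by
          exact ((measureReal_congr (Filter.eventuallyEq_univ.2 hcover)).trans
            probReal_univ).symm
      _ ≤ ∑ i ∈ Finset.Icc 1 k, stdSpace.real (symmDiff (E i) (E (i + 1))) :=
          measureReal_biUnion_finset_le _ _
      _ ≤ _ := by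
          rw [hS, Finset.mul_sum]
          exact Finset.sum_le_sum hcross
  have hSpos : 0 < S := by
    by_contra! h
    nlinarith
  have hle : S⁻¹ + 1 ≤ (r : ℝ) := by
    have : S⁻¹ ≤ (r : ℝ) - 1 := by rwa [inv_le_iff_one_le_mul₀ hSpos]
    linarith
  rw [← ENNReal.ofReal_inv_of_pos hSpos, ← ENNReal.ofReal_one,
    ← ENNReal.ofReal_add (by positivity) zero_le_one, ← ENNReal.ofReal_coe_nnreal]
  exact ENNReal.ofReal_le_ofReal hle

end
end
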